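/- arXiv:2505.09775 — 3 statements merged into one kernel-verified Lean document; each statement's English description precedes it below -/
import Mathlib

section
/- Let q be an integer with q ≥ 2. Then there do not exist an integer k ≥ 1, rational constants c_1, …, c_k, a sequence u : ℕ → ℚ satisfying the linear recurrence u_{n+k} = c_1·u_{n+k-1} + ⋯ + c_k·u_n for all n ≥ 0, and a bound N, such that for every prime p ≥ N the denominator of u_p is coprime to p and F_p(q) ≡ u_p (mod p). (In other words, the element (F_p(q) mod p)_p of the poor man's adèle ring is not represented by the reduction of any C-finite sequence, i.e., it is A-transcendental.) -/
/-- Schur's `q`-Fibonacci numbers: `F 0 = 0`, `F 1 = 1`,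
`F (n+2) = F (n+1) + q^n * F n`. -/
def qFib (q : ℤ) : ℕ → ℤ
  | 0 => 0
  | 1 => 1
  | n + 2 => qFib q (n + 1) + q ^ n * qFib q n

section Schur

variable {k : Type*} [Field k]

/-- Gaussian binomial coefficients at `x`, with lower index in `ℤ`. -/
def gaussBinom (x : k) : ℕ → ℤ → k
  | 0, i => if i = 0 then 1 else 0
  | n + 1, i => gaussBinom x n (i - 1) + x ^ i * gaussBinom x n i

theorem gaussBinom_eq_zero (x : k) (n : ℕ) (i : ℤ) (h : i < 0 ∨ (n : ℤ) < i) :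
    gaussBinom x n i = 0 := by
  induction n generalizing i with
  | zero => simp only [gaussBinom]; rw [if_neg]; push_cast at h; omega
  | succ n ih =>
    simp only [gaussBinom]
    push_cast at h
    rw [ih _ (by omega), ih _ (by omega)]; simp

theorem gaussBinom_zero_right (x : k) (n : ℕ) : gaussBinom x n 0 = 1 := by
  induction n with
  | zero => simp [gaussBinom]
  | succ n ih => simp [gaussBinom, ih, gaussBinom_eq_zero x n (-1) (by omega)]

theorem gaussBinom_self (x : k) (n : ℕ) : gaussBinom x n n = 1 := by
  induction n with
  | zero => simp [gaussBinom]
  | succ n ih =>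
    simp only [gaussBinom, Nat.cast_succ, add_sub_cancel_right, ih]
    rw [gaussBinom_eq_zero x n _ (by omega)]; simp

theorem gaussBinom_succ' {x : k} (hx : x ≠ 0) (n : ℕ) (i : ℤ) :
    gaussBinom x (n + 1) i = gaussBinom x n i + x ^ (n + 1 - i) * gaussBinom x n (i - 1) := by
  induction n generalizing i with
  | zero =>
    simp only [gaussBinom]
    rcases eq_or_ne i 0 with rfl | h0
    · simp
    rcases eq_or_ne i 1 with rfl | h1
    · simp
    · have : i - 1 ≠ 0 := by omega
      simp [h0, this]
  | succ n ih =>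
    have h1 : gaussBinom x (n + 1 + 1) i =
      gaussBinom x (n + 1) (i - 1) + x ^ i * gaussBinom x (n + 1) i := rfl
    have h2 : gaussBinom x (n + 1) i =
      gaussBinom x n (i - 1) + x ^ i * gaussBinom x n i := rfl
    have h3 : gaussBinom x (n + 1) (i - 1) =
      gaussBinom x n (i - 1 - 1) + x ^ (i - 1) * gaussBinom x n (i - 1) := rfl
    have e1 : x ^ i * x ^ ((n : ℤ) + 1 - i) = x ^ ((n : ℤ) + 1) := by
      rw [← zpow_add₀ hx]; ring_nf
    have e2 : x ^ ((n + 1 : ℕ) + 1 - i : ℤ) * x ^ (i - 1) = x ^ ((n : ℤ) + 1) := by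
      rw [← zpow_add₀ hx]; push_cast; ring_nf
    have e3 : (n + 1 - (i - 1) : ℤ) = (n + 1 : ℕ) + 1 - i := by push_cast; ring
    have h4 := ih (i - 1)
    have h5 := ih i
    rw [e3] at h4
    linear_combination h1 + h4 + x ^ i * h5 - h2 - x ^ ((n + 1 : ℕ) + 1 - i : ℤ) * h3 +
      gaussBinom x n (i - 1) * (e1 - e2)

theorem one_sub_mul_gaussBinom {x : k} (hx : x ≠ 0) (n : ℕ) (i : ℤ) :
    (1 - x ^ i) * gaussBinom x (n + 1) i = (1 - x ^ (n + 1)) * gaussBinom x n (i - 1) := by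
  have h1 := gaussBinom_succ' hx n i
  have h2 : gaussBinom x (n + 1) i = gaussBinom x n (i - 1) + x ^ i * gaussBinom x n i := rfl
  have e1 : x ^ i * x ^ ((n : ℤ) + 1 - i) = x ^ (n + 1) := by
    rw [← zpow_add₀ hx, ← zpow_natCast]; push_cast; ring_nf
  linear_combination h2 - x ^ i * h1 - gaussBinom x n (i - 1) * e1

/-- `j (5 j + 1) / 2`. -/
def schurExp (j : ℤ) : ℤ := j * (5 * j + 1) / 2

theorem two_mul_schurExp (j : ℤ) : 2 * schurExp j = j * (5 * j + 1) := by
  refine Int.mul_ediv_cancel' ?_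
  rcases Int.even_or_odd' j with ⟨c, rfl | rfl⟩
  · exact ⟨c * (5 * (2 * c) + 1), by ring⟩
  · exact ⟨(2 * c + 1) * (5 * c + 3), by ring⟩

/-- The general term of Schur's polynomial identity. -/
def schurTerm (x : k) (n : ℕ) (j : ℤ) : k :=
  (-1) ^ j * x ^ schurExp j * gaussBinom x n ((n - 5 * j) / 2)

/-- The quantity whose differences telescope in the proof of Schur's identity. -/
def schurTele (x : k) (n : ℕ) (j : ℤ) : k :=
  if Even ((n : ℤ) - 5 * j) then
    (-1) ^ j * x ^ (schurExp j + ((n : ℤ) + 2 - 5 * j) / 2) *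
      gaussBinom x n (((n : ℤ) + 2 - 5 * j) / 2) else 0

theorem schurTerm_add_two {x : k} (hx : x ≠ 0) (n : ℕ) (j : ℤ) :
    schurTerm x (n + 2) j - schurTerm x (n + 1) j - x ^ (n + 1) * schurTerm x n j =
      schurTele x n j - schurTele x n (j + 1) := by
  unfold schurTerm schurTele
  push_cast
  rcases Int.even_or_odd' ((n : ℤ) - 5 * j) with ⟨c, hc | hc⟩
  · have a1 : ((n : ℤ) + 2 - 5 * j) / 2 = c + 1 := by omega
    have a2 : ((n : ℤ) + 1 - 5 * j) / 2 = c := by omega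
    have a3 : ((n : ℤ) - 5 * j) / 2 = c := by omega
    have b1 : Even ((n : ℤ) - 5 * j) := ⟨c, by omega⟩
    have b2 : ¬ Even ((n : ℤ) - 5 * (j + 1)) := by
      rw [Int.not_even_iff_odd]; exact ⟨c - 3, by omega⟩
    rw [a1, a2, a3, if_pos b1, if_neg b2]
    have h2 : gaussBinom x (n + 1 + 1) (c + 1) =
      gaussBinom x (n + 1) (c + 1 - 1) + x ^ (c + 1) * gaussBinom x (n + 1) (c + 1) := rfl
    have h3 := gaussBinom_succ' hx n (c + 1)
    rw [add_sub_cancel_right] at h2 h3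
    have e1 : x ^ (c + 1) * x ^ ((n : ℤ) + 1 - (c + 1)) = x ^ (n + 1) := by
      rw [← zpow_add₀ hx, ← zpow_natCast]; push_cast; ring_nf
    rw [zpow_add₀ hx (schurExp j)]
    linear_combination (-1) ^ j * x ^ schurExp j *
      (h2 + x ^ (c + 1) * h3 + gaussBinom x n c * e1)
  · have a1 : ((n : ℤ) + 2 - 5 * j) / 2 = c + 1 := by omega
    have a2 : ((n : ℤ) + 1 - 5 * j) / 2 = c + 1 := by omega
    have a3 : ((n : ℤ) - 5 * j) / 2 = c := by omega
    have b1 : ¬ Even ((n : ℤ) - 5 * j) := by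
      rw [Int.not_even_iff_odd]; exact ⟨c, by omega⟩
    have b2 : Even ((n : ℤ) - 5 * (j + 1)) := ⟨c - 2, by omega⟩
    have a4 : ((n : ℤ) + 2 - 5 * (j + 1)) / 2 = c - 1 := by omega
    rw [a1, a2, a3, a4, if_neg b1, if_pos b2]
    have h2 := gaussBinom_succ' hx (n + 1) (c + 1)
    have h3 : gaussBinom x (n + 1) c =
      gaussBinom x n (c - 1) + x ^ c * gaussBinom x n c := rfl
    rw [add_sub_cancel_right] at h2
    have e1 : x ^ ((n + 1 : ℕ) + 1 - (c + 1) : ℤ) * x ^ c = x ^ (n + 1) := by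
      rw [← zpow_add₀ hx, ← zpow_natCast]; push_cast; ring_nf
    have e2 : x ^ (schurExp (j + 1) + (c - 1)) =
        x ^ schurExp j * x ^ ((n + 1 : ℕ) + 1 - (c + 1) : ℤ) := by
      rw [← zpow_add₀ hx]
      congr 1
      have := two_mul_schurExp j
      have := two_mul_schurExp (j + 1)
      push_cast
      linarith
    have e3 : (-1 : k) ^ (j + 1) = - (-1) ^ j := by
      rw [zpow_add₀ (by simp)]; simp
    rw [e2, e3]
    linear_combination (-1) ^ j * x ^ schurExp j *
      (h2 + x ^ ((n + 1 : ℕ) + 1 - (c + 1) : ℤ) * h3 + gaussBinom x n c * e1)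

/-- Schur's `q`-Fibonacci numbers at an element of a field. -/
def schurFib (x : k) : ℕ → k
  | 0 => 0
  | 1 => 1
  | n + 2 => schurFib x (n + 1) + x ^ n * schurFib x n

theorem schurTele_eq_zero (x : k) (n : ℕ) (j : ℤ) (h : (n : ℤ) < j ∨ j < -n) :
    schurTele x n j = 0 := by
  unfold schurTele
  split_ifs
  · rw [gaussBinom_eq_zero x n _ (by omega), mul_zero]
  · rfl

/-- **Schur's identity**: the `q`-Fibonacci numbers as an alternating sum of Gaussian
binomial coefficients. -/
theorem schurFib_succ_eq_sum {x : k} (hx : x ≠ 0) (N : ℕ) (n : ℕ) (hn : n + 2 ≤ N) :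
    schurFib x (n + 1) = ∑ j ∈ Finset.range (2 * N), schurTerm x n (j - N) := by
  induction n using Nat.strong_induction_on with
  | _ n ih =>
  match n with
  | 0 =>
    rw [Finset.sum_eq_single N]
    · simp [schurTerm, schurExp, schurFib, gaussBinom]
    · intro j _ hj
      have h1 : ((j : ℤ) - N) ≠ 0 := by omega
      have : gaussBinom x 0 (((0 : ℕ) - 5 * ((j : ℤ) - N)) / 2) = 0 := by
        refine gaussBinom_eq_zero _ _ _ ?_
        push_cast; omega
      rw [schurTerm, this, mul_zero]
    · intro h; exact absurd (Finset.mem_range.2 (by omega)) h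
  | 1 =>
    rw [Finset.sum_eq_single N]
    · simp [schurTerm, schurExp, schurFib, gaussBinom_zero_right]
    · intro j _ hj
      have h1 : ((j : ℤ) - N) ≠ 0 := by omega
      have : gaussBinom x 1 (((1 : ℕ) - 5 * ((j : ℤ) - N)) / 2) = 0 := by
        refine gaussBinom_eq_zero _ _ _ ?_
        push_cast; omega
      rw [schurTerm, this, mul_zero]
    · intro h; exact absurd (Finset.mem_range.2 (by omega)) h
  | n + 2 =>
    have h := Finset.sum_congr (rfl : Finset.range (2 * N) = _)
      fun j _ => schurTerm_add_two hx n ((j : ℤ) - N)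
    have h' : ∑ j ∈ Finset.range (2 * N),
        (schurTele x n ((j : ℤ) - N) - schurTele x n ((j : ℤ) - N + 1)) = 0 := by
      have := Finset.sum_range_sub' (fun j : ℕ => schurTele x n ((j : ℤ) - N)) (2 * N)
      push_cast at this
      have e : ∀ j : ℕ, (j : ℤ) - N + 1 = j + 1 - N := fun j => by ring
      simp only [e, this]
      rw [schurTele_eq_zero x n _ (by omega), schurTele_eq_zero x n _ (by omega), sub_zero]
    rw [h', Finset.sum_sub_distrib, Finset.sum_sub_distrib, ← Finset.mul_sum,
      ← ih n (by omega) (by omega), ← ih (n + 1) (by omega) (by omega)] at h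
    rw [schurFib]
    linear_combination -h

theorem gaussBinom_eq_zero_of_isPrimitiveRoot {x : k} {d : ℕ} (hx : IsPrimitiveRoot x d)
    (hd : 0 < d) {i : ℤ} (h0 : 0 < i) (h1 : i < d) : gaussBinom x d i = 0 := by
  obtain ⟨n, rfl⟩ : ∃ n, d = n + 1 := ⟨d - 1, by omega⟩
  have h := one_sub_mul_gaussBinom (hx.ne_zero hd.ne') n i
  rw [hx.pow_eq_one, sub_self, zero_mul] at h
  refine (mul_eq_zero.1 h).resolve_left fun h => ?_
  have h2 : x ^ i = 1 := (sub_eq_zero.1 h).symm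
  rw [hx.zpow_eq_one_iff_dvd] at h2
  exact absurd (Int.le_of_dvd h0 h2) (by omega)

theorem schurFib_succ_of_isPrimitiveRoot {x : k} {m : ℕ} (hm : 0 < m)
    (hx : IsPrimitiveRoot x (5 * m)) :
    schurFib x (5 * m + 1) =
      (-1) ^ m * (x ^ schurExp m + x ^ schurExp (-m)) := by
  have hx0 := hx.ne_zero (by omega)
  rw [schurFib_succ_eq_sum hx0 (5 * m + 2) (5 * m) le_rfl]
  rw [Finset.sum_eq_add (6 * m + 2) (4 * m + 2) (by omega)]
  · have e1 : ((6 * m + 2 : ℕ) : ℤ) - (5 * m + 2 : ℕ) = m := by push_cast; ring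
    have e2 : ((4 * m + 2 : ℕ) : ℤ) - (5 * m + 2 : ℕ) = -m := by push_cast; ring
    rw [e1, e2, schurTerm, schurTerm]
    have a1 : (((5 * m : ℕ) : ℤ) - 5 * m) / 2 = 0 := by omega
    have a2 : (((5 * m : ℕ) : ℤ) - 5 * (-m)) / 2 = (5 * m : ℕ) := by omega
    rw [a1, a2, gaussBinom_self, gaussBinom_zero_right, zpow_neg, zpow_natCast, ← inv_pow,
      inv_neg_one]
    ring
  · intro j _ hj
    rw [schurTerm]
    by_cases h : 0 ≤ (((5 * m : ℕ) : ℤ) - 5 * (j - (5 * m + 2 : ℕ))) / 2 ∧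
      (((5 * m : ℕ) : ℤ) - 5 * (j - (5 * m + 2 : ℕ))) / 2 ≤ (5 * m : ℕ)
    · rw [gaussBinom_eq_zero_of_isPrimitiveRoot hx (by omega) (by omega) (by omega), mul_zero]
    · rw [gaussBinom_eq_zero _ _ _ (by omega), mul_zero]
  · intro h; exact absurd (Finset.mem_range.2 (by omega)) h
  · intro h; exact absurd (Finset.mem_range.2 (by omega)) h

theorem schurFib_add_two_of_isPrimitiveRoot {x : k} {m : ℕ} (hm : 0 < m)
    (hx : IsPrimitiveRoot x (5 * m)) :
    schurFib x (5 * m + 2) =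
      (-1) ^ m * (x ^ schurExp m + x ^ schurExp (-m)) := by
  have hx0 := hx.ne_zero (by omega)
  rw [schurFib_succ_eq_sum hx0 (5 * m + 3) (5 * m + 1) le_rfl]
  rw [Finset.sum_eq_add (6 * m + 3) (4 * m + 3) (by omega)]
  · have e1 : ((6 * m + 3 : ℕ) : ℤ) - (5 * m + 3 : ℕ) = m := by push_cast; ring
    have e2 : ((4 * m + 3 : ℕ) : ℤ) - (5 * m + 3 : ℕ) = -m := by push_cast; ring
    rw [e1, e2, schurTerm, schurTerm]
    have a1 : (((5 * m + 1 : ℕ) : ℤ) - 5 * m) / 2 = 0 := by omega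
    have a2 : (((5 * m + 1 : ℕ) : ℤ) - 5 * (-m)) / 2 = (5 * m : ℕ) := by omega
    have a3 : gaussBinom x (5 * m + 1) (5 * m : ℕ) =
      gaussBinom x (5 * m) ((5 * m : ℕ) - 1) +
        x ^ ((5 * m : ℕ) : ℤ) * gaussBinom x (5 * m) (5 * m : ℕ) := rfl
    rw [a1, a2, a3, gaussBinom_self,
      gaussBinom_eq_zero_of_isPrimitiveRoot hx (by omega) (by omega) (by omega),
      gaussBinom_zero_right, zpow_neg, zpow_natCast, zpow_natCast, hx.pow_eq_one, ← inv_pow,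
      inv_neg_one]
    ring
  · intro j _ hj
    rw [schurTerm]
    set i := (((5 * m + 1 : ℕ) : ℤ) - 5 * (j - (5 * m + 3 : ℕ))) / 2 with hi
    by_cases h : 0 ≤ i ∧ i ≤ (5 * m + 1 : ℕ)
    · have a3 : gaussBinom x (5 * m + 1) i =
        gaussBinom x (5 * m) (i - 1) + x ^ i * gaussBinom x (5 * m) i := rfl
      rw [a3, gaussBinom_eq_zero_of_isPrimitiveRoot hx (by omega) (by omega) (by omega),
        gaussBinom_eq_zero_of_isPrimitiveRoot hx (by omega) (by omega) (by omega)]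
      simp
    · rw [gaussBinom_eq_zero _ _ _ (by omega), mul_zero]
  · intro h; exact absurd (Finset.mem_range.2 (by omega)) h
  · intro h; exact absurd (Finset.mem_range.2 (by omega)) h

/-- At a root of unity of order divisible by `5`, the `q`-Fibonacci numbers in the residue class
of `1` are powers of a root of `X ^ 2 - X - 1`. -/
theorem exists_schurFib_eq_pow {x : k} {m : ℕ} (hm : 0 < m) (hx : IsPrimitiveRoot x (5 * m)) :
    ∃ s : k, s ^ 2 = s + 1 ∧ ∀ I : ℕ, schurFib x (I * (5 * m) + 1) = s ^ I := by
  have hx0 := hx.ne_zero (by omega)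
  have h1 := schurFib_succ_of_isPrimitiveRoot hm hx
  have h2 := schurFib_add_two_of_isPrimitiveRoot hm hx
  refine ⟨schurFib x (5 * m + 1), ?_, ?_⟩
  · have hω : IsPrimitiveRoot (x ^ m) 5 := hx.pow (by omega) (by ring)
    have h5 : (x ^ m) ^ 5 = 1 := hω.pow_eq_one
    have hsum : 1 + x ^ m + (x ^ m) ^ 2 + (x ^ m) ^ 3 + (x ^ m) ^ 4 = 0 := by
      have := hω.geom_sum_eq_zero (by norm_num)
      simpa [Finset.sum_range_succ] using this
    obtain ⟨a, ha⟩ : ∃ a, a = x ^ schurExp m := ⟨_, rfl⟩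
    obtain ⟨b, hb⟩ : ∃ b, b = x ^ schurExp (-m) := ⟨_, rfl⟩
    have hab : a * b = 1 := by
      rw [ha, hb, ← zpow_add₀ hx0]
      have e : schurExp m + schurExp (-m) = ((5 * m : ℕ) : ℤ) * m := by
        have := two_mul_schurExp m
        have := two_mul_schurExp (-m)
        push_cast
        linarith
      rw [e, zpow_mul, zpow_natCast x (5 * m), hx.pow_eq_one, one_zpow]
    have ha2 : a ^ 2 = x ^ m := by
      rw [ha, ← zpow_natCast, ← zpow_mul]
      have e : schurExp m * (2 : ℕ) = ((5 * m : ℕ) : ℤ) * m + m := by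
        have := two_mul_schurExp m
        push_cast
        linarith
      rw [e, zpow_add₀ hx0, zpow_mul, zpow_natCast x (5 * m), hx.pow_eq_one, one_zpow, zpow_natCast,
        one_mul]
    have ha5 : a ^ 5 = (-1) ^ (m + 1) := by
      rcases Nat.even_or_odd' m with ⟨c, hc | hc⟩
      · have hy : x ^ (5 * c) = -1 := by
          have : (x ^ (5 * c)) ^ 2 = 1 := by
            rw [← pow_mul, ← hx.pow_eq_one, hc]; ring_nf
          refine (sq_eq_sq_iff_eq_or_eq_neg.1 (this.trans (one_pow 2).symm)).resolve_left ?_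
          exact hx.pow_ne_one_of_pos_of_lt (by omega) (by omega)
        have e : schurExp m * (5 : ℕ) = ((5 * c : ℕ) : ℤ) * (10 * c + 1 : ℕ) := by
          have := two_mul_schurExp m
          rw [hc] at this ⊢
          push_cast at this ⊢
          linarith
        rw [ha, ← zpow_natCast, ← zpow_mul, e, zpow_mul, zpow_natCast, zpow_natCast, hy, hc]
        rw [Odd.neg_one_pow ⟨5 * c, by ring⟩, Odd.neg_one_pow ⟨c, by ring⟩]
      · have e : schurExp m * (5 : ℕ) = ((5 * m : ℕ) : ℤ) * (5 * c + 3 : ℕ) := by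
          have := two_mul_schurExp m
          rw [hc] at this ⊢
          push_cast at this ⊢
          linarith
        rw [ha, ← zpow_natCast, ← zpow_mul, e, zpow_mul, zpow_natCast, zpow_natCast,
          hx.pow_eq_one, hc, one_pow]
        simp [pow_add, pow_mul]
    rw [h1, ← ha, ← hb]
    generalize x ^ m = ω at *
    have hε : ((-1 : k) ^ m) ^ 2 = 1 := by rw [← pow_mul, mul_comm, pow_mul]; simp
    rw [pow_succ (-1 : k)] at ha5
    generalize (-1 : k) ^ m = ε at *
    have hea : ε * a = - ω ^ 3 := by
      have h : a * ω ^ 2 = ε * -1 := by rw [← ha2, ← ha5]; ring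
      linear_combination -(ε * a) * h5 + ε * ω ^ 3 * h - ω ^ 3 * hε
    have heb : ε * b = - ω ^ 2 := by
      linear_combination (-ω ^ 2) * hab - b * ω^2 * a * hε + b * ω ^ 2 * ε * hea - ε * b * h5
    rw [mul_add, hea, heb]
    linear_combination ω * h5 + hsum + 2 * h5
  · have h0 : schurFib x (5 * m) = 0 := by
      have : schurFib x (5 * m + 2) =
        schurFib x (5 * m + 1) + x ^ (5 * m) * schurFib x (5 * m) := rfl
      rw [h2, h1, hx.pow_eq_one] at this
      linear_combination -this
    have key : ∀ n, schurFib x (n + 5 * m) = schurFib x (5 * m + 1) * schurFib x n ∧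
        schurFib x (n + 1 + 5 * m) = schurFib x (5 * m + 1) * schurFib x (n + 1) := by
      intro n
      induction n with
      | zero =>
        constructor
        · rw [zero_add, h0, schurFib, mul_zero]
        · rw [zero_add, add_comm 1, schurFib, mul_one]
      | succ n ih =>
        refine ⟨ih.2, ?_⟩
        have e1 : schurFib x (n + 1 + 1 + 5 * m) =
            schurFib x (n + 1 + 5 * m) + x ^ (n + 5 * m) * schurFib x (n + 5 * m) := by
          have : n + 1 + 1 + 5 * m = n + 5 * m + 2 := by ring
          rw [this, schurFib]; congr 2; ring
        have e2 : schurFib x (n + 1 + 1) = schurFib x (n + 1) + x ^ n * schurFib x n := rfl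
        rw [e1, e2, ih.1, ih.2, pow_add, hx.pow_eq_one]
        ring
    intro I
    induction I with
    | zero => simp [schurFib]
    | succ I ih =>
      have : (I + 1) * (5 * m) + 1 = I * (5 * m) + 1 + 5 * m := by ring
      rw [this, (key _).1, ih]; ring

end Schur

section PrimeIdealSums

open NumberField IsDedekindDomain Filter Topology

variable (K : Type*) [Field K] [NumberField K]

/-- The Dedekind zeta function at a real number, as a sum over all ideals. -/
noncomputable def realZeta (s : ℝ) : ℝ := ∑' I : Ideal (𝓞 K), (Ideal.absNorm I : ℝ) ^ (-s)

theorem hasSum_absNorm_rpow {s : ℝ} (hs : 1 < s)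
    (h : LSeriesSummable (fun n => (Nat.card {I : Ideal (𝓞 K) // Ideal.absNorm I = n} : ℂ)) s) :
    Summable (fun I : Ideal (𝓞 K) => (Ideal.absNorm I : ℝ) ^ (-s)) ∧
      (realZeta K s : ℂ) = dedekindZeta K s := by
  set c : ℕ → ℕ := fun n => Nat.card {I : Ideal (𝓞 K) // Ideal.absNorm I = n} with hc
  have hterm : ∀ n, LSeries.term (fun n => (c n : ℂ)) s n = ((c n * (n : ℝ) ^ (-s) : ℝ) : ℂ) := by
    intro n
    rcases eq_or_ne n 0 with rfl | hn
    · simp [Real.zero_rpow (by linarith : -s ≠ 0)]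
    · rw [LSeries.term_of_ne_zero hn, Complex.ofReal_mul, Complex.ofReal_cpow (by positivity),
        Complex.ofReal_neg, Complex.cpow_neg]
      simp [div_eq_mul_inv]
  have h1 : Summable fun n => c n * (n : ℝ) ^ (-s) := by
    rw [LSeriesSummable, funext hterm] at h
    exact_mod_cast h
  have hfib : ∀ n, HasSum (fun I : {I : Ideal (𝓞 K) // Ideal.absNorm I = n} =>
      (Ideal.absNorm I.1 : ℝ) ^ (-s)) (c n * (n : ℝ) ^ (-s)) := by
    intro n
    have : Finite {I : Ideal (𝓞 K) // Ideal.absNorm I = n} := Ideal.finite_setOfPred_absNorm_eq n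
    have := Fintype.ofFinite {I : Ideal (𝓞 K) // Ideal.absNorm I = n}
    have h2 := hasSum_fintype (fun I : {I : Ideal (𝓞 K) // Ideal.absNorm I = n} =>
      (Ideal.absNorm I.1 : ℝ) ^ (-s))
    convert h2 using 1
    rw [Finset.sum_congr rfl (fun I _ => by rw [I.2])]
    simp [hc]
  have h3 : Summable fun x : (Σ n, {I : Ideal (𝓞 K) // Ideal.absNorm I = n}) =>
      (Ideal.absNorm x.2.1 : ℝ) ^ (-s) := by
    refine (summable_sigma_of_nonneg fun x => by positivity).2
      ⟨fun n => (hfib n).summable, ?_⟩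
    simpa only [(hfib _).tsum_eq] using h1
  have h4 : Summable (fun I : Ideal (𝓞 K) => (Ideal.absNorm I : ℝ) ^ (-s)) :=
    (Equiv.sigmaFiberEquiv (fun I : Ideal (𝓞 K) => Ideal.absNorm I)).summable_iff.1 h3
  refine ⟨h4, ?_⟩
  have h5 : realZeta K s = ∑' n, c n * (n : ℝ) ^ (-s) := by
    rw [realZeta, ← (Equiv.sigmaFiberEquiv (fun I : Ideal (𝓞 K) => Ideal.absNorm I)).tsum_eq]
    refine (h3.tsum_sigma' fun n => (hfib n).summable).trans ?_
    simp only [(hfib _).tsum_eq]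
  rw [h5, dedekindZeta, LSeries, tsum_congr hterm, Complex.ofReal_tsum]

theorem eventually_realZeta_bounds : ∃ c C : ℝ, 0 < c ∧ ∀ᶠ s : ℝ in 𝓝[>] 1,
    Summable (fun I : Ideal (𝓞 K) => (Ideal.absNorm I : ℝ) ^ (-s)) ∧
      c ≤ (s - 1) * realZeta K s ∧ (s - 1) * realZeta K s ≤ C := by
  have h := tendsto_sub_one_mul_dedekindZeta_nhdsGT K
  have hr := dedekindZeta_residue_pos K
  set r := dedekindZeta_residue K with hr'
  refine ⟨r / 2, 2 * r, by positivity, ?_⟩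
  have h2 : Tendsto (fun s : ℝ => (((s - 1) * dedekindZeta K s : ℂ)).re) (𝓝[>] 1) (𝓝 r) := by
    have := (Complex.continuous_re.tendsto _).comp h
    rw [Complex.ofReal_re] at this
    exact this
  filter_upwards [h2.eventually (lt_mem_nhds (by linarith : r / 2 < r)),
    h2.eventually (gt_mem_nhds (by linarith : r < 2 * r)), self_mem_nhdsWithin] with s h3 h4 hs
  have hsum : LSeriesSummable
      (fun n => (Nat.card {I : Ideal (𝓞 K) // Ideal.absNorm I = n} : ℂ)) s := by
    by_contra hns
    have : dedekindZeta K s = 0 := tsum_eq_zero_of_not_summable hns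
    rw [this] at h3
    simp at h3
    linarith
  obtain ⟨h5, h6⟩ := hasSum_absNorm_rpow K hs hsum
  rw [← h6] at h3 h4
  have e : (((s - 1) * (realZeta K s : ℂ) : ℂ)).re = (s - 1) * realZeta K s := by
    exact_mod_cast Complex.ofReal_re ((s - 1) * realZeta K s)
  rw [e] at h3 h4
  exact ⟨h5, h3.le, h4.le⟩

variable {K}

theorem prod_one_add_le_realZeta {s : ℝ}
    (h : Summable (fun I : Ideal (𝓞 K) => (Ideal.absNorm I : ℝ) ^ (-s)))
    (T : Finset (HeightOneSpectrum (𝓞 K))) :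
    ∏ v ∈ T, (1 + (Ideal.absNorm v.asIdeal : ℝ) ^ (-s)) ≤ realZeta K s := by
  classical
  rw [Finset.prod_one_add]
  have hinj : Set.InjOn (fun S : Finset (HeightOneSpectrum (𝓞 K)) => ∏ v ∈ S, v.asIdeal)
      T.powerset := by
    have hmem : ∀ (S : Finset (HeightOneSpectrum (𝓞 K))) (v : HeightOneSpectrum (𝓞 K)),
        v ∈ S ↔ v.asIdeal ∣ ∏ w ∈ S, w.asIdeal := by
      refine fun S v => ⟨fun hv => Finset.dvd_prod_of_mem _ hv, fun hv => ?_⟩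
      obtain ⟨w, hw, hvw⟩ := (v.prime.dvd_finsetProd_iff _).1 hv
      have : v = w := HeightOneSpectrum.ext
        ((w.isMaximal.eq_of_le v.isPrime.ne_top (Ideal.le_of_dvd hvw)).symm)
      exact this ▸ hw
    intro S _ S' _ hSS
    ext v
    rw [hmem S, hmem S']
    exact iff_of_eq (congrArg _ hSS)
  have e : ∀ S ∈ T.powerset, ∏ v ∈ S, (Ideal.absNorm v.asIdeal : ℝ) ^ (-s) =
      (Ideal.absNorm (∏ v ∈ S, v.asIdeal) : ℝ) ^ (-s) := by
    intro S _
    rw [map_prod, Nat.cast_prod, Real.finsetProd_rpow _ _ fun _ _ => by positivity]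
  rw [Finset.sum_congr rfl e,
    ← Finset.sum_image (f := fun I : Ideal (𝓞 K) => (Ideal.absNorm I : ℝ) ^ (-s)) hinj]
  exact h.sum_le_tsum _ fun _ _ => by positivity

theorem exists_finset_factorization (A : Finset (Ideal (𝓞 K))) (hA : ∀ I ∈ A, I ≠ 0) :
    ∃ (T : Finset (HeightOneSpectrum (𝓞 K))) (e : Ideal (𝓞 K) → HeightOneSpectrum (𝓞 K) → ℕ),
      ∀ I ∈ A, I = ∏ v ∈ T, v.asIdeal ^ e I v := by
  classical
  have hfin : ∀ I : Ideal (𝓞 K), ∃ T : Finset (HeightOneSpectrum (𝓞 K)), I ≠ 0 →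
      ∀ v : HeightOneSpectrum (𝓞 K), v.asIdeal ∣ I → v ∈ T := by
    intro I
    by_cases h : I = 0
    · exact ⟨∅, fun h' => absurd h h'⟩
    · exact ⟨(Ideal.finite_factors h).toFinset, fun _ v hv => by simpa using hv⟩
  choose T hT using hfin
  refine ⟨A.biUnion T, fun I v => (Associates.mk v.asIdeal).count (Associates.mk I).factors,
    fun I hI => ?_⟩
  have hI0 := hA I hI
  conv_lhs => rw [← Ideal.finprod_heightOneSpectrum_factorization hI0]
  rw [finprod_eq_prod_of_mulSupport_subset]
  · rfl
  · intro v hv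
    rw [Finset.mem_coe, Finset.mem_biUnion]
    refine ⟨I, hI, hT I hI0 v ?_⟩
    by_contra hnd
    refine hv ?_
    have h0 : (Associates.mk v.asIdeal).count (Associates.mk I).factors = 0 := by
      by_contra hne
      exact hnd ((Associates.count_ne_zero_iff_dvd hI0 v.irreducible).1 hne)
    change v.asIdeal ^ _ = _
    rw [h0, pow_zero]

theorem sum_prod_pow_le {ι V : Type*} (A : Finset ι) (T : Finset V) (e : ι → V → ℕ) (x : V → ℝ)
    (hx0 : ∀ v, 0 ≤ x v) (hx1 : ∀ v, x v < 1)
    (hinj : ∀ i ∈ A, ∀ j ∈ A, (∀ v ∈ T, e i v = e j v) → i = j) :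
    ∑ i ∈ A, ∏ v ∈ T, x v ^ e i v ≤ ∏ v ∈ T, (1 - x v)⁻¹ := by
  classical
  obtain ⟨L, hlt⟩ : ∃ L, ∀ I ∈ A, ∀ v ∈ T, e I v < L := by
    refine ⟨∑ I ∈ A, ∑ v ∈ T, e I v + 1, fun I hI v hv => Nat.lt_succ_of_le ?_⟩
    have h1 := Finset.single_le_sum (s := T) (f := fun v => e I v) (fun _ _ => Nat.zero_le _) hv
    have h2 := Finset.single_le_sum (s := A) (f := fun I => ∑ v ∈ T, e I v)
      (fun _ _ => Nat.zero_le _) hI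
    exact h1.trans h2
  have hinj' : Set.InjOn (fun i (v : V) (_ : v ∈ T) => e i v) A := fun i hi j hj hij =>
    hinj i hi j hj fun v hv => congrFun (congrFun hij v) hv
  calc ∑ i ∈ A, ∏ v ∈ T, x v ^ e i v = ∑ i ∈ A, ∏ v ∈ T.attach, x v.1 ^ e i v.1 :=
        Finset.sum_congr rfl fun i _ => (Finset.prod_attach T (fun v => x v ^ e i v)).symm
    _ = ∑ f ∈ A.image (fun i (v : V) (_ : v ∈ T) => e i v),
          ∏ v ∈ T.attach, x v.1 ^ f v.1 v.2 := by rw [Finset.sum_image hinj']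
    _ ≤ ∑ f ∈ T.pi (fun _ => Finset.range L), ∏ v ∈ T.attach, x v.1 ^ f v.1 v.2 := by
        refine Finset.sum_le_sum_of_subset_of_nonneg ?_ fun _ _ _ =>
          Finset.prod_nonneg fun v _ => pow_nonneg (hx0 _) _
        intro f hf
        obtain ⟨I, hI, rfl⟩ := Finset.mem_image.1 hf
        exact Finset.mem_pi.2 fun v hv => Finset.mem_range.2 (hlt I hI v hv)
    _ = ∏ v ∈ T, ∑ i ∈ Finset.range L, x v ^ i := by rw [Finset.prod_sum]
    _ ≤ ∏ v ∈ T, (1 - x v)⁻¹ :=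
        Finset.prod_le_prod (fun v _ => Finset.sum_nonneg fun i _ => pow_nonneg (hx0 _) _)
          fun v _ => sum_le_hasSum _ (fun i _ => pow_nonneg (hx0 _) _)
            (hasSum_geometric_of_lt_one (hx0 v) (hx1 v))

theorem sum_absNorm_rpow_le {s : ℝ} (hs : 1 < s) (A : Finset (Ideal (𝓞 K))) :
    ∃ T : Finset (HeightOneSpectrum (𝓞 K)), ∑ I ∈ A, (Ideal.absNorm I : ℝ) ^ (-s) ≤
      ∏ v ∈ T, (1 - (Ideal.absNorm v.asIdeal : ℝ) ^ (-s))⁻¹ := by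
  classical
  obtain ⟨A', hA0, hA⟩ : ∃ A' : Finset (Ideal (𝓞 K)), (∀ I ∈ A', I ≠ 0) ∧
      ∑ I ∈ A, (Ideal.absNorm I : ℝ) ^ (-s) = ∑ I ∈ A', (Ideal.absNorm I : ℝ) ^ (-s) := by
    refine ⟨A.filter (fun I => I ≠ 0), fun I hI => (Finset.mem_filter.1 hI).2, ?_⟩
    rw [Finset.sum_filter_of_ne]
    rintro I _ hI rfl
    simp [Real.zero_rpow (by linarith : -s ≠ 0)] at hI
  obtain ⟨T, e, hfac⟩ := exists_finset_factorization A' hA0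
  refine ⟨T, ?_⟩
  have hx1 : ∀ v : HeightOneSpectrum (𝓞 K), (Ideal.absNorm v.asIdeal : ℝ) ^ (-s) < 1 := by
    intro v
    have h1 : 1 < Ideal.absNorm v.asIdeal := by
      have h2 : Ideal.absNorm v.asIdeal ≠ 0 := Ideal.absNorm_eq_zero_iff.not.2 v.ne_bot
      have h3 : Ideal.absNorm v.asIdeal ≠ 1 := Ideal.absNorm_eq_one_iff.not.2 v.isPrime.ne_top
      omega
    exact Real.rpow_lt_one_of_one_lt_of_neg (by exact_mod_cast h1) (by linarith)
  have hterm : ∀ I ∈ A', (Ideal.absNorm I : ℝ) ^ (-s) =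
      ∏ v ∈ T, ((Ideal.absNorm v.asIdeal : ℝ) ^ (-s)) ^ e I v := by
    intro I hI
    conv_lhs => rw [hfac I hI]
    rw [map_prod, Nat.cast_prod, ← Real.finsetProd_rpow _ _ fun _ _ => by positivity]
    refine Finset.prod_congr rfl fun v _ => ?_
    rw [map_pow, Nat.cast_pow, ← Real.rpow_natCast, ← Real.rpow_natCast, ← Real.rpow_mul
      (by positivity), ← Real.rpow_mul (by positivity), mul_comm]
  rw [hA, Finset.sum_congr rfl hterm]
  refine sum_prod_pow_le A' T e _ (fun v => by positivity) hx1 ?_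
  intro I hI J hJ hIJ
  rw [hfac I hI, hfac J hJ]
  exact Finset.prod_congr rfl fun v hv => by rw [hIJ v hv]

end PrimeIdealSums

section PrimeIdealSums

open NumberField IsDedekindDomain Filter Topology

variable (K : Type*) [Field K] [NumberField K]

theorem exists_residue_prime (v : HeightOneSpectrum (𝓞 K)) :
    ∃ p n : ℕ, 0 < n ∧ (p : 𝓞 K) ∈ v.asIdeal ∧ p.Prime ∧ Ideal.absNorm v.asIdeal = p ^ n := by
  have := v.isMaximal
  exact Ideal.exists_prime_and_absNorm_eq_pow v.asIdeal

theorem prime_eq_of_mem {v : HeightOneSpectrum (𝓞 K)} {p q : ℕ} (hp : p.Prime) (hq : q.Prime)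
    (hpv : (p : 𝓞 K) ∈ v.asIdeal) (hqv : (q : 𝓞 K) ∈ v.asIdeal) : p = q := by
  by_contra hne
  have h := (Nat.coprime_primes hp hq).2 hne
  refine v.isPrime.ne_top ((Ideal.eq_top_iff_one _).2 ?_)
  have h1 : ((p : ℤ) * p.gcdA q + q * p.gcdB q : ℤ) = 1 := by
    rw [← Nat.gcd_eq_gcd_ab, h]; rfl
  have h2 : (p : 𝓞 K) * (p.gcdA q : ℤ) + q * (p.gcdB q : ℤ) = 1 := by
    exact_mod_cast congrArg (Int.cast : ℤ → 𝓞 K) h1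
  rw [← h2]
  exact add_mem (Ideal.mul_mem_right _ _ hpv) (Ideal.mul_mem_right _ _ hqv)

theorem card_le_finrank_of_mem {p : ℕ} (hp : p.Prime) (S : Finset (HeightOneSpectrum (𝓞 K)))
    (hS : ∀ v ∈ S, (p : 𝓞 K) ∈ v.asIdeal) : S.card ≤ Module.finrank ℚ K := by
  have h1 : ∏ v ∈ S, v.asIdeal ∣ Ideal.span {(p : 𝓞 K)} := by
    refine Finset.prod_dvd_of_isRelPrime ?_ fun v hv => ?_
    · intro v hv w hw hvw
      refine (Ideal.isCoprime_iff_sup_eq.2 ?_).isRelPrime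
      exact v.isMaximal.coprime_of_ne w.isMaximal fun h => hvw (HeightOneSpectrum.ext h)
    · exact Ideal.dvd_iff_le.2 ((Ideal.span_singleton_le_iff_mem _).2 (hS v hv))
  have h2 := map_dvd Ideal.absNorm h1
  rw [Ideal.absNorm_span_natCast, map_prod, RingOfIntegers.rank] at h2
  have h3 := Nat.le_of_dvd (pow_pos hp.pos _) h2
  have h4 : p ^ S.card ≤ ∏ v ∈ S, Ideal.absNorm v.asIdeal := by
    rw [← Finset.prod_const]
    refine Finset.prod_le_prod' fun v hv => ?_
    obtain ⟨r, n, hn, hr, hrp, hN⟩ := exists_residue_prime K v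
    rw [hN, prime_eq_of_mem K hp hrp (hS v hv) hr]
    exact Nat.le_self_pow hn.ne' _
  exact (Nat.pow_le_pow_iff_right hp.one_lt).1 (h4.trans h3)

theorem sum_inv_sq_residue_prime_le (π : HeightOneSpectrum (𝓞 K) → ℕ)
    (hπ : ∀ v, (π v).Prime ∧ (π v : 𝓞 K) ∈ v.asIdeal) (T : Finset (HeightOneSpectrum (𝓞 K))) :
    ∑ v ∈ T, ((π v : ℝ) ^ 2)⁻¹ ≤ Module.finrank ℚ K * ∑' k : ℕ, ((k : ℝ) ^ 2)⁻¹ := by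
  classical
  have hsum : Summable fun k : ℕ => ((k : ℝ) ^ 2)⁻¹ := Real.summable_nat_pow_inv.2 one_lt_two
  rw [← Finset.sum_fiberwise_of_maps_to (t := T.image π)
    (fun v hv => Finset.mem_image_of_mem _ hv)]
  calc _ ≤ ∑ p ∈ T.image π, Module.finrank ℚ K * ((p : ℝ) ^ 2)⁻¹ := by
        refine Finset.sum_le_sum fun p hp => ?_
        obtain ⟨w, hw, rfl⟩ := Finset.mem_image.1 hp
        rw [Finset.sum_congr rfl (g := fun _ => ((π w : ℝ) ^ 2)⁻¹)
          fun v hv => by rw [(Finset.mem_filter.1 hv).2], Finset.sum_const, nsmul_eq_mul]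
        gcongr
        exact card_le_finrank_of_mem K (hπ w).1 _ fun v hv => by
          rw [← (Finset.mem_filter.1 hv).2]; exact (hπ v).2
    _ ≤ _ := by
        rw [← Finset.mul_sum]
        gcongr
        exact hsum.sum_le_tsum _ fun _ _ => by positivity

/-- Uniform bounds for the part of `∑ N v ^ (-s)` which stays finite at `s = 1`. -/
theorem exists_sum_sq_bound : ∃ C : ℝ, ∀ s : ℝ, 1 < s → ∀ T : Finset (HeightOneSpectrum (𝓞 K)),
    ∑ v ∈ T, ((Ideal.absNorm v.asIdeal : ℝ) ^ (-s)) ^ 2 ≤ C ∧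
    ((∀ v ∈ T, ¬ (Ideal.absNorm v.asIdeal).Prime) →
      ∑ v ∈ T, (Ideal.absNorm v.asIdeal : ℝ) ^ (-s) ≤ C) := by
  choose π f hf hπv hπ hN using exists_residue_prime K
  refine ⟨_, fun s hs T => ⟨le_trans (Finset.sum_le_sum fun v _ => ?_)
      (sum_inv_sq_residue_prime_le K π (fun v => ⟨hπ v, hπv v⟩) T),
    fun hT => le_trans (Finset.sum_le_sum fun v hv => ?_)
      (sum_inv_sq_residue_prime_le K π (fun v => ⟨hπ v, hπv v⟩) T)⟩⟩
  · have hp : (1 : ℝ) < π v := by exact_mod_cast (hπ v).one_lt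
    have h1 : (π v : ℝ) ≤ Ideal.absNorm v.asIdeal := by
      rw [hN]; exact_mod_cast Nat.le_self_pow (hf v).ne' _
    have h2 : (Ideal.absNorm v.asIdeal : ℝ) ^ (-s) ≤ (π v : ℝ)⁻¹ := by
      rw [Real.rpow_neg (by positivity)]
      gcongr
      exact h1.trans (Real.self_le_rpow_of_one_le (by linarith) hs.le)
    rw [← inv_pow]
    gcongr
  · have hp : (1 : ℝ) < π v := by exact_mod_cast (hπ v).one_lt
    have h1 : (π v : ℝ) ^ 2 ≤ Ideal.absNorm v.asIdeal := by
      have hf2 : 2 ≤ f v := by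
        by_contra h
        have : f v = 1 := by have := hf v; omega
        refine hT v hv ?_
        rw [hN, this, pow_one]
        exact hπ v
      rw [hN]; exact_mod_cast Nat.pow_le_pow_right (hπ v).pos hf2
    rw [Real.rpow_neg (by positivity)]
    gcongr
    refine h1.trans (Real.self_le_rpow_of_one_le (le_trans ?_ h1) hs.le)
    exact one_le_pow₀ hp.le

/-- The number of ring homomorphisms from the ring of integers to `ZMod p`. -/
noncomputable def homCount (p : ℕ) : ℕ := Nat.card (𝓞 K →+* ZMod p)

theorem finite_absNorm_eq (p : ℕ) :
    {v : HeightOneSpectrum (𝓞 K) | Ideal.absNorm v.asIdeal = p}.Finite :=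
  (Ideal.finite_setOfPred_absNorm_eq (S := 𝓞 K) p).of_injOn (f := fun v => v.asIdeal)
    (fun _ hv => hv) fun _ _ _ _ h => HeightOneSpectrum.ext h

theorem nonempty_hom_equiv {p : ℕ} (hp : p.Prime) :
    Nonempty ((𝓞 K →+* ZMod p) ≃
      {v : HeightOneSpectrum (𝓞 K) | Ideal.absNorm v.asIdeal = p}) := by
  have := Fact.mk hp
  have hsurj : ∀ g : 𝓞 K →+* ZMod p, Function.Surjective g := fun g => ZMod.ringHom_surjective g
  have hnorm : ∀ g : 𝓞 K →+* ZMod p, Ideal.absNorm (RingHom.ker g) = p := by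
    intro g
    rw [Ideal.absNorm_apply, Submodule.cardQuot_apply]
    exact (Nat.card_congr (RingHom.quotientKerEquivOfSurjective (hsurj g)).toEquiv).trans
      (Nat.card_zmod p)
  refine ⟨Equiv.ofBijective (fun g => ⟨⟨RingHom.ker g, RingHom.ker_isPrime g, ?_⟩,
    hnorm g⟩) ⟨?_, ?_⟩⟩
  · intro h
    have := hnorm g
    rw [h, Ideal.absNorm_bot] at this
    exact hp.ne_zero this.symm
  · intro f g hfg
    have hk : RingHom.ker f = RingHom.ker g :=
      congrArg (fun v => HeightOneSpectrum.asIdeal v) (congrArg Subtype.val hfg)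
    ext1 x
    have h1 : x - ((f x).val : 𝓞 K) ∈ RingHom.ker f := by
      rw [RingHom.mem_ker, map_sub, map_natCast, ZMod.natCast_zmod_val, sub_self]
    rw [hk, RingHom.mem_ker, map_sub, map_natCast, ZMod.natCast_zmod_val, sub_eq_zero] at h1
    exact h1.symm
  · rintro ⟨v, hv⟩
    have hv' : Nat.card (𝓞 K ⧸ v.asIdeal) = p := hv
    have : Finite (𝓞 K ⧸ v.asIdeal) := Nat.finite_of_card_ne_zero (by rw [hv']; exact hp.ne_zero)
    have := Fintype.ofFinite (𝓞 K ⧸ v.asIdeal)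
    let e := ZMod.ringEquivOfPrime (𝓞 K ⧸ v.asIdeal) hp (by rw [← Nat.card_eq_fintype_card, hv'])
    refine ⟨(e.symm : 𝓞 K ⧸ v.asIdeal →+* ZMod p).comp (Ideal.Quotient.mk v.asIdeal), ?_⟩
    refine Subtype.ext (HeightOneSpectrum.ext ?_)
    ext x
    simp [RingHom.mem_ker, Ideal.Quotient.eq_zero_iff_mem]

theorem finite_hom {p : ℕ} (hp : p.Prime) : Finite (𝓞 K →+* ZMod p) := by
  obtain ⟨e⟩ := nonempty_hom_equiv K hp
  have := (finite_absNorm_eq K p).to_subtype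
  exact Finite.of_equiv _ e.symm

theorem homCount_eq {p : ℕ} (hp : p.Prime) :
    homCount K p = (finite_absNorm_eq K p).toFinset.card := by
  rw [← Nat.card_eq_card_finite_toFinset, homCount]
  exact Nat.card_congr (nonempty_hom_equiv K hp).some

theorem homCount_le {p : ℕ} (hp : p.Prime) : homCount K p ≤ Module.finrank ℚ K := by
  rw [homCount_eq K hp]
  refine card_le_finrank_of_mem K hp _ fun v hv => ?_
  have hv : Ideal.absNorm v.asIdeal = p := by simpa using hv
  rw [← hv]
  exact Ideal.absNorm_mem _

/-- The Dirichlet series with coefficients `homCount`. -/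
noncomputable def homSum (s : ℝ) : ℝ := ∑' p : Nat.Primes, homCount K p * (p : ℝ) ^ (-s)

theorem summable_homSum {s : ℝ} (hs : 1 < s) :
    Summable fun p : Nat.Primes => homCount K p * (p : ℝ) ^ (-s) := by
  have h : Summable fun p : Nat.Primes => (p : ℝ) ^ (-s) := Nat.Primes.summable_rpow.2 (by linarith)
  refine Summable.of_nonneg_of_le (fun p => by positivity) (fun p => ?_)
    (h.mul_left (Module.finrank ℚ K : ℝ))
  gcongr
  exact homCount_le K p.2

theorem sum_homCount_eq (s : ℝ) (P : Finset Nat.Primes) :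
    ∃ T : Finset (HeightOneSpectrum (𝓞 K)),
      (∀ v : HeightOneSpectrum (𝓞 K), v ∈ T ↔ ∃ p ∈ P, Ideal.absNorm v.asIdeal = p) ∧
      ∑ p ∈ P, homCount K p * (p : ℝ) ^ (-s) = ∑ v ∈ T, (Ideal.absNorm v.asIdeal : ℝ) ^ (-s) := by
  classical
  refine ⟨P.biUnion fun p => (finite_absNorm_eq K p).toFinset, fun v => by simp, ?_⟩
  rw [Finset.sum_biUnion]
  · refine Finset.sum_congr rfl fun p _ => ?_
    rw [homCount_eq K p.2, ← nsmul_eq_mul, ← Finset.sum_const]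
    refine Finset.sum_congr rfl fun v hv => ?_
    rw [show Ideal.absNorm v.asIdeal = p by simpa using hv]
  · intro p _ q _ hpq
    rw [Function.onFun, Finset.disjoint_left]
    intro v hv hv'
    simp only [Set.Finite.mem_toFinset, Set.mem_ofPred_eq] at hv hv'
    exact hpq (Subtype.ext (hv.symm.trans hv'))

theorem sum_le_homSum {s : ℝ} (hs : 1 < s) (T : Finset (HeightOneSpectrum (𝓞 K)))
    (hT : ∀ v ∈ T, (Ideal.absNorm v.asIdeal).Prime) :
    ∑ v ∈ T, (Ideal.absNorm v.asIdeal : ℝ) ^ (-s) ≤ homSum K s := by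
  classical
  obtain ⟨g, hg⟩ : ∃ g : HeightOneSpectrum (𝓞 K) → Nat.Primes,
      ∀ v ∈ T, Ideal.absNorm v.asIdeal = g v := by
    have h : ∀ v : HeightOneSpectrum (𝓞 K), ∃ r : Nat.Primes,
        v ∈ T → Ideal.absNorm v.asIdeal = r := by
      intro v
      by_cases hv : v ∈ T
      · exact ⟨⟨_, hT v hv⟩, fun _ => rfl⟩
      · exact ⟨⟨2, Nat.prime_two⟩, fun h => absurd h hv⟩
    choose g hg using h
    exact ⟨g, hg⟩
  obtain ⟨T', hT', hsum'⟩ := sum_homCount_eq K s (T.image g)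
  refine le_trans ?_ ((summable_homSum K hs).sum_le_tsum (T.image g) fun _ _ => by positivity)
  rw [hsum']
  refine Finset.sum_le_sum_of_subset_of_nonneg (fun v hv => ?_) fun v _ _ => by positivity
  rw [hT']
  exact ⟨g v, Finset.mem_image_of_mem g hv, hg v hv⟩

theorem exp_sub_sq_le {x : ℝ} (h0 : 0 ≤ x) : Real.exp (x - x ^ 2) ≤ 1 + x := by
  have h1 := Real.add_one_le_exp (-(x - x ^ 2))
  have h2 : Real.exp (x - x ^ 2) * Real.exp (-(x - x ^ 2)) = 1 := by
    rw [← Real.exp_add]; simp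
  have h3 := Real.exp_pos (x - x ^ 2)
  nlinarith [mul_le_mul_of_nonneg_left h1 h3.le, mul_le_mul_of_nonneg_left h1 (mul_nonneg h3.le h0),
    mul_nonneg h3.le (pow_nonneg h0 3)]

theorem inv_one_sub_le_exp {x : ℝ} (h1 : x ≤ 1 / 2) :
    (1 - x)⁻¹ ≤ Real.exp (x + 2 * x ^ 2) := by
  rw [inv_le_iff_one_le_mul₀ (by linarith)]
  have h2 := Real.add_one_le_exp (x + 2 * x ^ 2)
  nlinarith [mul_le_mul_of_nonneg_right h2 (by linarith : (0 : ℝ) ≤ 1 - x), sq_nonneg x,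
    mul_nonneg (sq_nonneg x) (by linarith : (0 : ℝ) ≤ 1 - 2 * x)]

theorem homSum_bounds : ∃ C : ℝ, ∀ᶠ s : ℝ in 𝓝[>] 1, |homSum K s + Real.log (s - 1)| ≤ C := by
  obtain ⟨c, C, hc, hev⟩ := eventually_realZeta_bounds K
  obtain ⟨B, hB⟩ := exists_sum_sq_bound K
  refine ⟨max (Real.log C + B) (3 * B - Real.log c), ?_⟩
  filter_upwards [hev, self_mem_nhdsWithin] with s ⟨hsum, hlow, hup⟩ hs
  have hs : 1 < s := hs
  have hs1 : 0 < s - 1 := by linarith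
  have hZ : 0 < realZeta K s := (mul_pos_iff_of_pos_left hs1).1 (hc.trans_le hlow)
  have hCpos : 0 < C := hc.trans_le (hlow.trans hup)
  have hx0 : ∀ v : HeightOneSpectrum (𝓞 K), 0 ≤ (Ideal.absNorm v.asIdeal : ℝ) ^ (-s) :=
    fun v => by positivity
  have hupper : homSum K s ≤ Real.log (realZeta K s) + B := by
    refine Real.tsum_le_of_sum_le (fun p => by positivity) fun P => ?_
    obtain ⟨T, -, hT⟩ := sum_homCount_eq K s P
    rw [hT]
    have h1 : Real.exp (∑ v ∈ T, ((Ideal.absNorm v.asIdeal : ℝ) ^ (-s) -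
        ((Ideal.absNorm v.asIdeal : ℝ) ^ (-s)) ^ 2)) ≤ realZeta K s := by
      rw [Real.exp_sum]
      exact (Finset.prod_le_prod (fun v _ => (Real.exp_pos _).le)
        fun v _ => exp_sub_sq_le (hx0 v)).trans (prod_one_add_le_realZeta hsum T)
    rw [← Real.le_log_iff_exp_le hZ, Finset.sum_sub_distrib] at h1
    have h2 := (hB s hs T).1
    linarith
  have hlower : Real.log (realZeta K s) ≤ homSum K s + 3 * B := by
    rw [Real.log_le_iff_le_exp hZ]
    refine Real.tsum_le_of_sum_le (fun I => by positivity) fun A => ?_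
    obtain ⟨T, hT⟩ := sum_absNorm_rpow_le hs A
    refine hT.trans ?_
    have h1 : ∏ v ∈ T, (1 - (Ideal.absNorm v.asIdeal : ℝ) ^ (-s))⁻¹ ≤
        Real.exp (∑ v ∈ T, ((Ideal.absNorm v.asIdeal : ℝ) ^ (-s) +
          2 * ((Ideal.absNorm v.asIdeal : ℝ) ^ (-s)) ^ 2)) := by
      rw [Real.exp_sum]
      have hhalf : ∀ v : HeightOneSpectrum (𝓞 K),
          (Ideal.absNorm v.asIdeal : ℝ) ^ (-s) ≤ 1 / 2 := by
        intro v
        have h2 : 2 ≤ Ideal.absNorm v.asIdeal := by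
          have h2 : Ideal.absNorm v.asIdeal ≠ 0 := Ideal.absNorm_eq_zero_iff.not.2 v.ne_bot
          have h3 : Ideal.absNorm v.asIdeal ≠ 1 := Ideal.absNorm_eq_one_iff.not.2 v.isPrime.ne_top
          omega
        have h2 : (2 : ℝ) ≤ Ideal.absNorm v.asIdeal := by exact_mod_cast h2
        rw [Real.rpow_neg (by positivity), one_div]
        gcongr
        exact h2.trans (Real.self_le_rpow_of_one_le (by linarith) hs.le)
      refine Finset.prod_le_prod (fun v _ => inv_nonneg.2 ?_)
        fun v _ => inv_one_sub_le_exp (hhalf v)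
      linarith [hhalf v]
    refine h1.trans (Real.exp_le_exp.2 ?_)
    classical
    rw [Finset.sum_add_distrib, ← Finset.mul_sum]
    have h2 := (hB s hs T).1
    have h3 := (hB s hs (T.filter fun v => ¬ (Ideal.absNorm v.asIdeal).Prime)).2
      fun v hv => (Finset.mem_filter.1 hv).2
    have h4 := Finset.sum_filter_add_sum_filter_not T
      (fun v => (Ideal.absNorm v.asIdeal).Prime)
      (fun v => (Ideal.absNorm v.asIdeal : ℝ) ^ (-s))
    have h5 : ∑ v ∈ T.filter (fun v => (Ideal.absNorm v.asIdeal).Prime),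
        (Ideal.absNorm v.asIdeal : ℝ) ^ (-s) ≤ homSum K s :=
      sum_le_homSum K hs _ fun v hv => (Finset.mem_filter.1 hv).2
    linarith
  have h1 : Real.log (realZeta K s) ≤ Real.log C - Real.log (s - 1) := by
    rw [← Real.log_div hCpos.ne' hs1.ne']
    exact Real.log_le_log hZ ((le_div_iff₀' hs1).2 hup)
  have h2 : Real.log c - Real.log (s - 1) ≤ Real.log (realZeta K s) := by
    rw [← Real.log_div hc.ne' hs1.ne']
    exact Real.log_le_log (by positivity) ((div_le_iff₀' hs1).2 hlow)
  rw [abs_le]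
  exact ⟨by linarith [le_max_right (Real.log C + B) (3 * B - Real.log c)],
    by linarith [le_max_left (Real.log C + B) (3 * B - Real.log c)]⟩

/-- Comparison of Dirichlet densities of primes counted by homomorphisms. -/
theorem exists_homCount_lt (E E₁ E₂ : Type*) [Field E] [NumberField E] [Field E₁] [NumberField E₁]
    [Field E₂] [NumberField E₂] (N : ℕ) : ∃ p, p.Prime ∧ N ≤ p ∧
      homCount E₁ p + homCount E₂ p < 5 * homCount E p := by
  by_contra! hcon
  obtain ⟨C, hC⟩ := homSum_bounds E
  obtain ⟨C₁, hC₁⟩ := homSum_bounds E₁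
  obtain ⟨C₂, hC₂⟩ := homSum_bounds E₂
  set g : Nat.Primes → ℝ := fun p => if (p : ℕ) < N then 5 * (homCount E p : ℝ) else 0 with hg
  have hgs : Summable g := by
    refine summable_of_hasFiniteSupport ?_
    refine Set.Finite.subset (s := (fun p : Nat.Primes => (p : ℕ)) ⁻¹' (Set.Iio N))
      ((Set.finite_Iio N).preimage (Subtype.val_injective.injOn)) ?_
    intro p hp
    by_contra h
    exact hp (if_neg h)
  have hev : ∀ᶠ s : ℝ in 𝓝[>] 1, -Real.log (s - 1) ≤ (5 * C + C₁ + C₂ + ∑' p, g p) / 3 := by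
    filter_upwards [hC, hC₁, hC₂, self_mem_nhdsWithin] with s h h₁ h₂ hs
    have hs : 1 < s := hs
    have hle : 5 * homSum E s ≤ homSum E₁ s + homSum E₂ s + ∑' p, g p := by
      rw [homSum, homSum, homSum, ← tsum_mul_left,
        ← (summable_homSum E₁ hs).tsum_add (summable_homSum E₂ hs),
        ← ((summable_homSum E₁ hs).add (summable_homSum E₂ hs)).tsum_add hgs]
      refine ((summable_homSum E hs).mul_left 5).tsum_le_tsum (fun p => ?_)
        (((summable_homSum E₁ hs).add (summable_homSum E₂ hs)).add hgs)
      have hp0 : 0 ≤ (p : ℝ) ^ (-s) := by positivity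
      by_cases hpN : (p : ℕ) < N
      · have hp1 : (p : ℝ) ^ (-s) ≤ 1 :=
          Real.rpow_le_one_of_one_le_of_nonpos (by exact_mod_cast p.2.one_lt.le) (by linarith)
        simp only [hg, if_pos hpN]
        have : (0 : ℝ) ≤ homCount E p := by positivity
        have : (0 : ℝ) ≤ homCount E₁ p * (p : ℝ) ^ (-s) := by positivity
        have : (0 : ℝ) ≤ homCount E₂ p * (p : ℝ) ^ (-s) := by positivity
        nlinarith
      · simp only [hg, if_neg hpN, add_zero]
        have : (5 * homCount E p : ℝ) ≤ homCount E₁ p + homCount E₂ p := by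
          exact_mod_cast hcon p p.2 (not_lt.1 hpN)
        rw [← mul_assoc, ← add_mul]
        gcongr
    rw [abs_le] at h h₁ h₂
    linarith
  have hlim : Tendsto (fun s : ℝ => -Real.log (s - 1)) (𝓝[>] 1) atTop := by
    refine tendsto_neg_atBot_atTop.comp (Real.tendsto_log_nhdsGT_zero.comp ?_)
    refine tendsto_nhdsWithin_iff.2 ⟨?_, ?_⟩
    · have : Tendsto (fun s : ℝ => s - 1) (𝓝 1) (𝓝 (1 - 1)) :=
        (continuous_id.sub continuous_const).tendsto 1
      rw [sub_self] at this
      exact this.mono_left nhdsWithin_le_nhds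
    · filter_upwards [self_mem_nhdsWithin] with s hs
      exact sub_pos.2 (Set.mem_Ioi.1 hs)
  obtain ⟨s, h1, h2⟩ := (hev.and (hlim.eventually_gt_atTop _)).exists
  exact absurd h1 (not_le.2 h2)

end PrimeIdealSums

section Extension

open NumberField Polynomial

/-- A homomorphism to a field extends along a map whose cokernel is killed by an integer which is
invertible in the field. -/
theorem exists_ringHom_extension {A B F : Type*} [CommRing A] [CommRing B] [Field F]
    (i : A →+* B) (φ : A →+* F) (hker : RingHom.ker i ≤ RingHom.ker φ) (D : ℕ)
    (hD : ∀ b, ∃ a, i a = D * b) (hDF : (D : F) ≠ 0) : ∃ φ' : B →+* F, φ'.comp i = φ := by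
  choose g hg using hD
  have huniq : ∀ a a', i a = i a' → φ a = φ a' := by
    intro a a' h
    have : a - a' ∈ RingHom.ker i := by rw [RingHom.mem_ker, map_sub, h, sub_self]
    have := hker this
    rwa [RingHom.mem_ker, map_sub, sub_eq_zero] at this
  have hval : ∀ a, φ (g (i a)) = D * φ a := fun a => by
    rw [← map_natCast φ, ← map_mul]
    exact huniq _ _ (by rw [hg, map_mul, map_natCast])
  refine ⟨{ toFun := fun b => (D : F)⁻¹ * φ (g b), map_one' := ?_, map_mul' := ?_,
            map_zero' := ?_, map_add' := ?_ }, ?_⟩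
  · have := hval 1
    rw [map_one, map_one] at this
    rw [this, mul_one, inv_mul_cancel₀ hDF]
  · intro x y
    have h : φ (g x) * φ (g y) = D * φ (g (x * y)) := by
      rw [← map_natCast φ, ← map_mul, ← map_mul]
      exact huniq _ _ (by simp only [map_mul, map_natCast, hg]; ring)
    field_simp
    exact h.symm
  · have := hval 0
    rw [map_zero, map_zero] at this
    rw [this, mul_zero, mul_zero]
  · intro x y
    have h : φ (g (x + y)) = φ (g x) + φ (g y) := by
      rw [← map_add]
      exact huniq _ _ (by simp only [map_add, hg]; ring)
    rw [h, mul_add]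
  · ext a
    change (D : F)⁻¹ * φ (g (i a)) = φ a
    rw [hval, ← mul_assoc, inv_mul_cancel₀ hDF, one_mul]

universe u

variable {E : Type u} [Field E] [NumberField E]

theorem exists_nat_map_ne_zero {y : 𝓞 E} (hy : y ≠ 0) :
    ∃ N : ℕ, ∀ p, p.Prime → N < p → ∀ ψ : 𝓞 E →+* ZMod p, ψ y ≠ 0 := by
  refine ⟨Ideal.absNorm (Ideal.span {y}), fun p hp hN ψ h => ?_⟩
  have := Fact.mk hp
  have h1 := Ideal.absNorm_mem (Ideal.span {y})
  obtain ⟨z, hz⟩ := Ideal.mem_span_singleton.1 h1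
  have h2 : ((Ideal.absNorm (Ideal.span {y}) : ℕ) : ZMod p) = 0 := by
    rw [← map_natCast ψ, hz, map_mul, h, zero_mul]
  rw [ZMod.natCast_eq_zero_iff] at h2
  refine absurd (Nat.le_of_dvd (Nat.pos_of_ne_zero ?_) h2) (not_le.2 hN)
  rw [Ne, Ideal.absNorm_eq_zero_iff, Ideal.span_singleton_eq_bot]
  exact hy

theorem exists_nat_mul_mem_range {L : Type*} [Field L] [NumberField L] [Algebra E L] (η : 𝓞 L)
    (hη : Algebra.adjoin E {(η : L)} = ⊤) :
    ∃ D : ℕ, 0 < D ∧ ∀ b : 𝓞 L, ∃ f : (𝓞 E)[X], aeval η f = D * b := by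
  have hsingle : ∀ b : 𝓞 L, ∃ D : ℕ, 0 < D ∧ ∃ f : (𝓞 E)[X], aeval η f = D * b := by
    intro b
    have hb : (b : L) ∈ Algebra.adjoin E {(η : L)} := by rw [hη]; trivial
    rw [Algebra.adjoin_singleton_eq_range_aeval] at hb
    obtain ⟨g, hg⟩ := hb
    obtain ⟨d, hd, hdg⟩ := IsLocalization.integerNormalization_spec (nonZeroDivisors (𝓞 E)) g
    have hd0 : d ≠ 0 := nonZeroDivisors.ne_zero hd
    obtain ⟨z, hz⟩ := Ideal.mem_span_singleton.1 (Ideal.absNorm_mem (Ideal.span {d}))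
    refine ⟨Ideal.absNorm (Ideal.span {d}), Nat.pos_of_ne_zero ?_,
      C z * IsLocalization.integerNormalization (nonZeroDivisors (𝓞 E)) g, ?_⟩
    · rw [Ne, Ideal.absNorm_eq_zero_iff, Ideal.span_singleton_eq_bot]
      exact hd0
    · apply RingOfIntegers.ext
      have h5 : map (algebraMap (𝓞 E) E)
          (IsLocalization.integerNormalization (nonZeroDivisors (𝓞 E)) g) = C (d : E) * g := by
        rw [← smul_eq_C_mul]
        exact hdg
      have h1 := congrArg (aeval (η : L)) h5
      rw [aeval_map_algebraMap] at h1
      have h2 : ∀ f : (𝓞 E)[X], ((aeval η f : 𝓞 L) : L) = aeval (η : L) f := fun f =>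
        (aeval_algebraMap_apply L η f).symm
      rw [h2, map_mul, h1, map_mul, aeval_C, aeval_C]
      have h3 := congrArg (algebraMap (𝓞 E) L) hz
      rw [map_natCast, map_mul] at h3
      have hg' : aeval (η : L) g = (b : L) := hg
      have h4 : algebraMap E L (d : E) = algebraMap (𝓞 E) L d := rfl
      rw [hg', h4, ← mul_assoc, mul_comm (algebraMap (𝓞 E) L z), ← h3]
      simp
  choose D hD0 hD using hsingle
  obtain ⟨S, hS⟩ := (Module.Finite.fg_top : (⊤ : Submodule ℤ (𝓞 L)).FG)
  refine ⟨∏ b ∈ S, D b, Finset.prod_pos fun b _ => hD0 b, fun b => ?_⟩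
  have hb : b ∈ Submodule.span ℤ (S : Set (𝓞 L)) := by rw [hS]; trivial
  induction hb using Submodule.span_induction with
  | mem x hx =>
    obtain ⟨f, hf⟩ := hD x
    obtain ⟨e, he⟩ := Finset.dvd_prod_of_mem D (Finset.mem_coe.1 hx)
    exact ⟨(e : (𝓞 E)[X]) * f, by rw [map_mul, hf, he]; push_cast; simp; ring⟩
  | zero => exact ⟨0, by simp⟩
  | add x y _ _ hx hy =>
    obtain ⟨f, hf⟩ := hx
    obtain ⟨g, hg⟩ := hy
    exact ⟨f + g, by rw [map_add, hf, hg]; ring⟩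
  | smul a x _ hx =>
    obtain ⟨f, hf⟩ := hx
    exact ⟨(a : (𝓞 E)[X]) * f, by rw [map_mul, hf, map_intCast, zsmul_eq_mul]; ring⟩

theorem exists_extension_of_pow_eq (y : 𝓞 E) (hy : ∀ z : E, z ^ 5 ≠ y) :
    ∃ (L : Type u) (_ : Field L) (_ : NumberField L) (_ : Algebra E L) (η : 𝓞 L) (N : ℕ),
      ∀ p, p.Prime → N < p → ∀ (ψ : 𝓞 E →+* ZMod p) (w : ZMod p), w ^ 5 = ψ y →
        ∃ χ : 𝓞 L →+* ZMod p, χ.comp (algebraMap (𝓞 E) (𝓞 L)) = ψ ∧ χ η = w := by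
  have hirr : Irreducible (X ^ 5 - C (y : E)) := X_pow_sub_C_irreducible_of_prime (by norm_num) hy
  have hfact : Fact (Irreducible (X ^ 5 - C (y : E))) := ⟨hirr⟩
  have hmon : (X ^ 5 - C y : (𝓞 E)[X]).Monic := monic_X_pow_sub_C _ (by norm_num)
  have hmap : (X ^ 5 - C y : (𝓞 E)[X]).map (algebraMap (𝓞 E) E) = X ^ 5 - C (y : E) := by simp
  have hfin : Module.Finite E (AdjoinRoot (X ^ 5 - C (y : E))) :=
    (AdjoinRoot.powerBasis hirr.ne_zero).finite
  have hchar : CharZero (AdjoinRoot (X ^ 5 - C (y : E))) :=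
    charZero_of_injective_algebraMap (algebraMap E _).injective
  have hNF : NumberField (AdjoinRoot (X ^ 5 - C (y : E))) :=
    NumberField.of_module_finite E _
  have hroot : AdjoinRoot.root (X ^ 5 - C (y : E)) ^ 5 =
      algebraMap (𝓞 E) (AdjoinRoot (X ^ 5 - C (y : E))) y := by
    have h := AdjoinRoot.eval₂_root (X ^ 5 - C (y : E))
    rw [eval₂_sub, eval₂_X_pow, eval₂_C, sub_eq_zero] at h
    exact h
  have hint : IsIntegral ℤ (AdjoinRoot.root (X ^ 5 - C (y : E))) := by
    refine IsIntegral.of_pow (n := 5) (by norm_num) ?_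
    rw [hroot]
    exact (RingOfIntegers.isIntegral y).algebraMap
  let η : 𝓞 (AdjoinRoot (X ^ 5 - C (y : E))) := ⟨AdjoinRoot.root (X ^ 5 - C (y : E)), hint⟩
  obtain ⟨D, hD0, hD⟩ := exists_nat_mul_mem_range (E := E) η AdjoinRoot.adjoinRoot_eq_top
  refine ⟨AdjoinRoot (X ^ 5 - C (y : E)), inferInstance, hNF, inferInstance, η, D,
    fun p hp hDp ψ w hw => ?_⟩
  have := Fact.mk hp
  have hker : RingHom.ker (aeval η : (𝓞 E)[X] →ₐ[𝓞 E] _).toRingHom ≤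
      RingHom.ker (eval₂RingHom ψ w) := by
    intro f hf
    have h0 : aeval η f = 0 := hf
    have h1 : aeval (AdjoinRoot.root (X ^ 5 - C (y : E))) f = 0 := by
      have := aeval_algebraMap_apply (AdjoinRoot (X ^ 5 - C (y : E))) η f
      rw [h0, map_zero] at this
      exact this
    rw [← aeval_map_algebraMap E, AdjoinRoot.aeval_eq, AdjoinRoot.mk_eq_zero, ← hmap,
      map_dvd_map _ (FaithfulSMul.algebraMap_injective (𝓞 E) E) hmon] at h1
    obtain ⟨g, rfl⟩ := h1
    rw [RingHom.mem_ker, map_mul]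
    simp [hw]
  have hDp0 : (D : ZMod p) ≠ 0 := by
    rw [Ne, ZMod.natCast_eq_zero_iff]
    exact fun h => absurd (Nat.le_of_dvd hD0 h) (not_le.2 hDp)
  obtain ⟨χ, hχ⟩ := exists_ringHom_extension _ _ hker D hD hDp0
  refine ⟨χ, ?_, ?_⟩
  · ext a
    have := RingHom.congr_fun hχ (C a)
    simpa using this
  · have := RingHom.congr_fun hχ X
    simpa using this

theorem exists_five_mul_le_homCount {ω : 𝓞 E} (hω : IsPrimitiveRoot ω 5) (y : 𝓞 E)
    (hy : ∀ z : E, z ^ 5 ≠ y) :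
    ∃ (L : Type u) (_ : Field L) (_ : NumberField L) (N : ℕ), ∀ p, p.Prime → N < p →
      5 * {ψ : 𝓞 E →+* ZMod p | ∃ w, w ^ 5 = ψ y}.ncard ≤ homCount L p := by
  obtain ⟨L, _, _, _, η, N, hN⟩ := exists_extension_of_pow_eq y hy
  have hy0 : y ≠ 0 := fun h => hy 0 (by rw [h]; simp)
  obtain ⟨N1, hN1⟩ := exists_nat_map_ne_zero hy0
  obtain ⟨N2, hN2⟩ := exists_nat_map_ne_zero
    (sub_ne_zero.2 (hω.ne_one (by norm_num)) : ω - 1 ≠ 0)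
  refine ⟨L, inferInstance, inferInstance, N + N1 + N2, fun p hp hpN => ?_⟩
  have := Fact.mk hp
  have := finite_hom L hp
  have hprim : ∀ ψ : 𝓞 E →+* ZMod p, IsPrimitiveRoot (ψ ω) 5 := by
    intro ψ
    have h1 : ψ ω ≠ 1 := by
      have := hN2 p hp (by omega) ψ
      rwa [map_sub, map_one, sub_ne_zero] at this
    have := Fact.mk (show Nat.Prime 5 by norm_num)
    have h5 : orderOf (ψ ω) = 5 :=
      orderOf_eq_prime (by rw [← map_pow, hω.pow_eq_one, map_one]) h1
    exact h5 ▸ IsPrimitiveRoot.orderOf (ψ ω)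
  choose w hw using fun ψ : {ψ : 𝓞 E →+* ZMod p | ∃ w, w ^ 5 = ψ y} => ψ.2
  choose χ hχ hχη using fun (ψ : {ψ : 𝓞 E →+* ZMod p | ∃ w, w ^ 5 = ψ y}) (i : Fin 5) =>
    hN p hp (by omega) ψ (w ψ * (ψ : 𝓞 E →+* ZMod p) ω ^ (i : ℕ)) (by
      rw [mul_pow, hw, ← pow_mul, mul_comm (i : ℕ), pow_mul, (hprim ψ).pow_eq_one, one_pow,
        mul_one])
  have hinj : Function.Injective fun x : {ψ : 𝓞 E →+* ZMod p | ∃ w, w ^ 5 = ψ y} × Fin 5 =>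
      χ x.1 x.2 := by
    rintro ⟨ψ, i⟩ ⟨ψ', i'⟩ h
    have h : χ ψ i = χ ψ' i' := h
    have hψ : ψ = ψ' := Subtype.ext (by rw [← hχ ψ i, h, hχ])
    subst hψ
    have hw0 : w ψ ≠ 0 := fun h0 => hN1 p hp (by omega) ψ (by rw [← hw, h0]; simp)
    have h2 := hχη ψ i
    rw [h, hχη] at h2
    have h3 := (hprim ψ).pow_inj i.2 i'.2 (mul_left_cancel₀ hw0 h2).symm
    rw [Fin.ext h3]
  have := Nat.card_le_card_of_injective _ hinj
  rw [Nat.card_prod, Nat.card_fin, Nat.card_coe_set_eq] at this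
  rw [homCount]
  omega

/-- If `y₁` and `y₂` are not fifth powers in a number field containing the fifth roots of unity,
then both remain non-fifth powers modulo infinitely many primes of degree one. -/
theorem exists_prime_not_pow {ω : 𝓞 E} (hω : IsPrimitiveRoot ω 5) (y₁ y₂ : 𝓞 E)
    (h₁ : ∀ z : E, z ^ 5 ≠ y₁) (h₂ : ∀ z : E, z ^ 5 ≠ y₂) (N : ℕ) :
    ∃ p, p.Prime ∧ N < p ∧ ∃ ψ : 𝓞 E →+* ZMod p,
      (∀ w, w ^ 5 ≠ ψ y₁) ∧ ∀ w, w ^ 5 ≠ ψ y₂ := by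
  obtain ⟨L₁, _, _, N₁, hL₁⟩ := exists_five_mul_le_homCount hω y₁ h₁
  obtain ⟨L₂, _, _, N₂, hL₂⟩ := exists_five_mul_le_homCount hω y₂ h₂
  obtain ⟨p, hp, hpN, hlt⟩ := exists_homCount_lt E L₁ L₂ (N + N₁ + N₂ + 1)
  have := finite_hom E hp
  refine ⟨p, hp, by omega, ?_⟩
  by_contra! hcon
  have hsub : Set.univ ⊆ {ψ : 𝓞 E →+* ZMod p | ∃ w, w ^ 5 = ψ y₁} ∪
      {ψ : 𝓞 E →+* ZMod p | ∃ w, w ^ 5 = ψ y₂} := by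
    intro ψ _
    by_cases h : ∃ w, w ^ 5 = ψ y₁
    · exact Or.inl h
    · push Not at h
      exact Or.inr (hcon ψ h)
  have h1 := (Set.ncard_le_ncard hsub (Set.toFinite _)).trans (Set.ncard_union_le _ _)
  rw [Set.ncard_univ] at h1
  have h2 := hL₁ p hp (by omega)
  have h3 := hL₂ p hp (by omega)
  rw [← homCount] at h1
  omega

end Extension

section Kummer

open Polynomial IntermediateField ComplexConjugate

theorem exists_eq_mul_pow_of_kummer {F L : Type*} [Field F] [Field L] [Algebra F L]
    [FiniteDimensional F L] {t : ℕ} {ζ g : F} (hζ : IsPrimitiveRoot ζ (5 ^ (t + 1))) {ρ : L}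
    (hρ : ρ ^ 5 ^ (t + 1) = algebraMap F L g) (htop : F⟮ρ⟯ = ⊤) (hg : ∀ w : F, w ^ 5 ≠ g) {z : L}
    {b : F} (hz : z ^ 5 = algebraMap F L b) :
    ∃ (k : ℕ) (w : F), z = algebraMap F L w * (ρ ^ 5 ^ t) ^ k := by
  have hirr : Irreducible (X ^ 5 ^ (t + 1) - C g) :=
    X_pow_sub_C_irreducible_of_prime_pow (by norm_num) (by norm_num) _ hg
  have hmin : minpoly F ρ = X ^ 5 ^ (t + 1) - C g :=
    (minpoly.eq_of_irreducible_of_monic hirr (by simp [hρ])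
      (monic_X_pow_sub_C _ (by positivity))).symm
  have hrank : Module.finrank F L = 5 ^ (t + 1) := by
    rw [← finrank_top', ← htop, adjoin.finrank (Algebra.IsIntegral.isIntegral ρ), hmin,
      natDegree_X_pow_sub_C]
  have htfae := (isCyclic_tfae F L ⟨ζ, by
    rw [hrank, mem_primitiveRoots (by positivity)]; exact hζ⟩).out 2 0
  obtain ⟨hgal, hcyc⟩ := htfae.1 ⟨ρ, ⟨g, by rw [hrank, hρ]⟩, htop⟩
  obtain ⟨σ, hσ⟩ := hcyc.exists_generator
  have hfix : ∀ x : L, σ x = x → ∃ w : F, algebraMap F L w = x := by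
    intro x hx
    refine (IsGalois.mem_range_algebraMap_iff_fixed x).2 fun τ => ?_
    have hle : Subgroup.zpowers σ ≤ MulAction.stabilizer Gal(L/F) x := by
      rw [Subgroup.zpowers_le]
      exact hx
    exact hle (hσ τ)
  have hω : IsPrimitiveRoot (algebraMap F L (ζ ^ 5 ^ t)) 5 :=
    (hζ.pow (by positivity) (pow_succ 5 t)).map_of_injective (algebraMap F L).injective
  have hroot : ∀ y : L, ∀ a : F, y ≠ 0 → y ^ 5 = algebraMap F L a →
      ∃ i < 5, σ y = algebraMap F L (ζ ^ 5 ^ t) ^ i * y := by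
    intro y a hy0 hy
    have h1 : (σ y / y) ^ 5 = 1 := by
      rw [div_pow, ← map_pow, hy, AlgEquiv.commutes, ← hy, div_self (pow_ne_zero _ hy0)]
    obtain ⟨i, hi, h⟩ := hω.eq_pow_of_pow_eq_one h1
    exact ⟨i, hi, by rw [h, div_mul_cancel₀ _ hy0]⟩
  have hμ5 : (ρ ^ 5 ^ t) ^ 5 = algebraMap F L g := by rw [← pow_mul, ← pow_succ, hρ]
  have hμ0 : ρ ^ 5 ^ t ≠ 0 := by
    intro h0
    rw [h0, zero_pow (by norm_num)] at hμ5
    exact hg 0 ((algebraMap F L).injective (by rw [← hμ5]; simp))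
  rcases eq_or_ne z 0 with rfl | hz0
  · exact ⟨0, 0, by simp⟩
  obtain ⟨i, hi, hσμ⟩ := hroot _ _ hμ0 hμ5
  obtain ⟨j, hj, hσz⟩ := hroot _ _ hz0 hz
  have hi0 : i ≠ 0 := by
    rintro rfl
    obtain ⟨w, hw⟩ := hfix _ (by rw [hσμ, pow_zero, one_mul])
    exact hg w ((algebraMap F L).injective (by rw [map_pow, hw, hμ5]))
  obtain ⟨k, hk⟩ : ∃ k : ℕ, (i * k) % 5 = j := by
    interval_cases i <;> interval_cases j <;>
      first
      | exact absurd rfl hi0 | exact ⟨0, rfl⟩ | exact ⟨1, rfl⟩ | exact ⟨2, rfl⟩ | exact ⟨3, rfl⟩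
      | exact ⟨4, rfl⟩
  have hkey : algebraMap F L (ζ ^ 5 ^ t) ^ (i * k) = algebraMap F L (ζ ^ 5 ^ t) ^ j := by
    rw [← hk]
    have := pow_mod_orderOf (algebraMap F L (ζ ^ 5 ^ t)) (i * k)
    rwa [← hω.eq_orderOf, eq_comm] at this
  obtain ⟨w, hw⟩ := hfix (z / (ρ ^ 5 ^ t) ^ k) (by
    rw [map_div₀, map_pow, hσμ, hσz, mul_pow, ← pow_mul, hkey,
      mul_div_mul_left _ _ (pow_ne_zero _ (hω.ne_zero (by norm_num)))])
  exact ⟨k, w, by rw [hw, div_mul_cancel₀ _ (pow_ne_zero _ hμ0)]⟩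

theorem eq_of_conj_of_pow_five {x y : ℂ} (hx : conj x = x) (hy : conj y = y) (h : x ^ 5 = y ^ 5) :
    x = y := by
  obtain ⟨a, rfl⟩ := Complex.conj_eq_iff_real.1 hx
  obtain ⟨b, rfl⟩ := Complex.conj_eq_iff_real.1 hy
  have h' : a ^ 5 = b ^ 5 := by exact_mod_cast h
  rw [(show Odd 5 by decide).strictMono_pow.injective h']

theorem exists_real_pow_eq (r : ℝ) {n : ℕ} (hn : Odd n) : ∃ x : ℝ, x ^ n = r := by
  rcases le_total 0 r with h | h
  · exact ⟨r ^ (n : ℝ)⁻¹, Real.rpow_inv_natCast_pow h hn.pos.ne'⟩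
  · refine ⟨-((-r) ^ (n : ℝ)⁻¹), ?_⟩
    rw [hn.neg_pow, Real.rpow_inv_natCast_pow (by linarith) hn.pos.ne', neg_neg]

variable {F : IntermediateField ℚ ℂ} [IsAbelianGalois ℚ F]

open scoped IsMulCommutative in
theorem conj_gal_apply {x : F} (hx : conj (x : ℂ) = x) (σ : Gal(F/ℚ)) :
    conj (σ x : ℂ) = σ x := by
  have hc : ∀ y : F, (((Complex.conjAe.restrictScalars ℚ).restrictNormal F y : F) : ℂ) = conj (y : ℂ) :=
    fun y => AlgEquiv.restrictNormal_commutes (Complex.conjAe.restrictScalars ℚ) F y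
  have hcx : (Complex.conjAe.restrictScalars ℚ).restrictNormal F x = x :=
    Subtype.ext ((hc x).trans hx)
  rw [← hc, ← AlgEquiv.mul_apply, mul_comm, AlgEquiv.mul_apply, hcx]

theorem gal_eq_of_pow_five {x y : F} (hx : conj (x : ℂ) = x) (hy : conj (y : ℂ) = y)
    (σ τ : Gal(F/ℚ)) (h : σ x ^ 5 = τ y ^ 5) : σ x = τ y :=
  Subtype.ext (eq_of_conj_of_pow_five (conj_gal_apply hx σ) (conj_gal_apply hy τ)
    (by exact_mod_cast congrArg (Subtype.val) h))

variable [FiniteDimensional ℚ F]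

theorem exists_rat_eq_of_pow_five {x : F} (hx : conj (x : ℂ) = x) {b : ℚ}
    (hb : x ^ 5 = algebraMap ℚ F b) : ∃ a : ℚ, algebraMap ℚ F a = x := by
  refine (IsGalois.mem_range_algebraMap_iff_fixed x).2 fun τ => ?_
  refine gal_eq_of_pow_five hx hx τ 1 ?_
  rw [← map_pow, hb, AlgEquiv.commutes, ← hb]
  rfl

theorem exists_rat_pow_of_mul_pow_eq {g g' w : F} (hw : conj (w : ℂ) = w) {h : Gal(F/ℚ)}
    (hg : h g = g') (hgg : g * g' = -1) {k : ℕ} {b : ℚ}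
    (hb : w ^ 5 * g ^ k = algebraMap ℚ F b) : ∃ a : ℚ, a ^ 5 = b := by
  have h1 : h w ^ 5 * g' ^ k = algebraMap ℚ F b := by
    rw [← hg, ← map_pow, ← map_pow, ← map_mul, hb, AlgEquiv.commutes]
  have h2 : (w * h w) ^ 5 = algebraMap ℚ F ((-1) ^ k * b ^ 2) := by
    have h3 : ((-1 : F) ^ k) * (-1) ^ k = 1 := by rw [← mul_pow]; simp
    have h4 : g ^ k * g' ^ k = (-1) ^ k := by rw [← mul_pow, hgg]
    simp only [map_mul, map_pow, map_neg, map_one]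
    linear_combination (-1) ^ k * (h w ^ 5 * g' ^ k) * hb + (-1) ^ k * algebraMap ℚ F b * h1 -
      (w * h w) ^ 5 * h3 - (w * h w) ^ 5 * (-1) ^ k * h4
  obtain ⟨a, ha⟩ := exists_rat_eq_of_pow_five (by simp [hw, conj_gal_apply hw]) h2
  rw [← ha, ← map_pow] at h2
  have h3 := (algebraMap ℚ F).injective h2
  rcases eq_or_ne b 0 with rfl | hb0
  · exact ⟨0, by norm_num⟩
  refine ⟨(-1) ^ k * a ^ 3 / b, ?_⟩
  have h4 : ((-1 : ℚ) ^ k) * (-1) ^ k = 1 := by rw [← mul_pow]; simp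
  rw [div_pow, div_eq_iff (pow_ne_zero _ hb0)]
  have h5 : ((-1 : ℚ) ^ k) ^ 8 = 1 := by
    rw [show ((-1 : ℚ) ^ k) ^ 8 = (((-1 : ℚ) ^ k) * (-1) ^ k) ^ 4 by ring, h4, one_pow]
  calc ((-1) ^ k * a ^ 3) ^ 5 = ((-1) ^ k) ^ 5 * (a ^ 5) ^ 3 := by ring
    _ = ((-1) ^ k) ^ 8 * b ^ 6 := by rw [h3]; ring
    _ = b * b ^ 5 := by rw [h5]; ring

theorem rat_quintic_ne (m : ℚ) : m ^ 5 + 5 * m ^ 3 + 5 * m ≠ 1 := by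
  intro hm
  have hint : IsIntegral ℤ m := by
    refine ⟨X ^ 5 + (5 * X ^ 3 + 5 * X - 1), monic_X_pow_add ?_, ?_⟩
    · compute_degree!
    · simp only [eval₂_add, eval₂_sub, eval₂_mul, eval₂_pow, eval₂_X, eval₂_one]
      norm_num
      linarith
  obtain ⟨k, rfl⟩ := IsIntegrallyClosed.isIntegral_iff.1 hint
  have hk : k * (k ^ 4 + 5 * k ^ 2 + 5) = 1 := by
    have : ((k * (k ^ 4 + 5 * k ^ 2 + 5) : ℤ) : ℚ) = 1 := by
      push_cast
      rw [← hm, eq_intCast]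
      ring
    exact_mod_cast this
  rcases Int.isUnit_iff.1 (IsUnit.of_mul_eq_one _ hk) with rfl | rfl <;> norm_num at hk

theorem golden_ne_pow_five {g : F} (hg2 : g ^ 2 = g + 1) {h : Gal(F/ℚ)} (hg : h g = 1 - g) {w : F}
    (hw : conj (w : ℂ) = w) : w ^ 5 ≠ g := by
  intro hw5
  have hhw : h w ^ 5 = 1 - g := by rw [← map_pow, hw5, hg]
  have hn : w * h w = -1 := by
    apply Subtype.ext
    refine eq_of_conj_of_pow_five (by simp [hw, conj_gal_apply hw]) (by simp) ?_
    have : (w * h w) ^ 5 = (-1) ^ 5 := by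
      rw [mul_pow, hw5, hhw]
      linear_combination -hg2
    exact_mod_cast congrArg Subtype.val this
  have hm : (w + h w) ^ 5 + 5 * (w + h w) ^ 3 + 5 * (w + h w) = 1 := by
    linear_combination hw5 + hhw + (5 * (w + h w) ^ 3 -
      5 * (w + h w) * (w * h w - 1)) * hn
  have hmfix : ∃ m : ℚ, algebraMap ℚ F m = w + h w := by
    refine (IsGalois.mem_range_algebraMap_iff_fixed _).2 fun τ => ?_
    have hτ : (τ g - g) * (τ g - (1 - g)) = 0 := by
      have : τ g ^ 2 = τ g + 1 := by rw [← map_pow, hg2, map_add, map_one]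
      linear_combination this - hg2
    have e1 : ((1 : Gal(F/ℚ)) w) = w := rfl
    rcases mul_eq_zero.1 hτ with h0 | h0
    · have h0 := sub_eq_zero.1 h0
      have h1 := gal_eq_of_pow_five hw hw τ 1 (by rw [← map_pow, hw5, h0, e1, hw5])
      have h2 := gal_eq_of_pow_five hw hw (τ * h) h (by
        rw [AlgEquiv.mul_apply, ← map_pow, ← map_pow, hw5, hg, map_sub, map_one, h0])
      rw [map_add, h1, ← AlgEquiv.mul_apply, h2, e1]
    · have h0 := sub_eq_zero.1 h0
      have h1 := gal_eq_of_pow_five hw hw τ h (by rw [← map_pow, hw5, h0, hhw])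
      have h2 := gal_eq_of_pow_five hw hw (τ * h) 1 (by
        rw [AlgEquiv.mul_apply, ← map_pow, ← map_pow, hw5, hg, map_sub, map_one, h0, e1, hw5,
          sub_sub_cancel])
      rw [map_add, h1, ← AlgEquiv.mul_apply, h2, e1, add_comm]
  obtain ⟨m, hm'⟩ := hmfix
  rw [← hm'] at hm
  refine rat_quintic_ne m ((algebraMap ℚ F).injective ?_)
  simpa using hm

end Kummer

section KummerFields

open Polynomial IntermediateField ComplexConjugate

theorem exists_conj_root {S : Type*} [SetLike S ℂ] [SubfieldClass S ℂ] {F : S} {ω : ℂ}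
    (hω : IsPrimitiveRoot ω 5) (hωF : ω ∈ F) {w x : ℂ} (hx : conj x = x) (hw : w ∈ F)
    (hwx : w ^ 5 = x) : ∃ v ∈ F, conj v = v ∧ v ^ 5 = x := by
  obtain ⟨a, rfl⟩ := Complex.conj_eq_iff_real.1 hx
  obtain ⟨r, hr⟩ := exists_real_pow_eq a (show Odd 5 by decide)
  have hrx : (r : ℂ) ^ 5 = a := by exact_mod_cast hr
  refine ⟨r, ?_, Complex.conj_ofReal r, hrx⟩
  rcases eq_or_ne (r : ℂ) 0 with h0 | h0
  · rw [h0]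
    exact zero_mem F
  · have h1 : (w / r) ^ 5 = 1 := by rw [div_pow, hwx, hrx, ← hrx, div_self (pow_ne_zero _ h0)]
    obtain ⟨i, -, hi⟩ := hω.eq_pow_of_pow_eq_one h1
    have h2 : (r : ℂ) = w / ω ^ i := by
      rw [eq_div_iff (pow_ne_zero _ (hω.ne_zero (by norm_num))), hi, mul_div_cancel₀ _ h0]
    rw [h2]
    exact div_mem hw (pow_mem hωF i)

theorem rat_sq_ne_add_one (a : ℚ) : a ^ 2 ≠ a + 1 := by
  intro ha
  have h5 : Irrational (√5) := by exact_mod_cast Nat.Prime.irrational_sqrt (p := 5) (by norm_num)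
  have h : ((2 * a - 1 : ℚ) : ℝ) ^ 2 = 5 := by
    have : (2 * a - 1) ^ 2 = 5 := by linear_combination 4 * ha
    exact_mod_cast this
  refine h5 ⟨|2 * a - 1|, ?_⟩
  rw [← h, Real.sqrt_sq_eq_abs, Rat.cast_abs]

variable {t : ℕ} {ζ : ℂ}

theorem exists_golden (hζ : IsPrimitiveRoot ζ (5 ^ (t + 1))) :
    ∃ g : ℂ, g ∈ ℚ⟮ζ⟯ ∧ conj g = g ∧ g ^ 2 = g + 1 := by
  have hω : IsPrimitiveRoot (ζ ^ 5 ^ t) 5 := hζ.pow (by positivity) (pow_succ 5 t)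
  have hmem : ζ ^ 5 ^ t ∈ ℚ⟮ζ⟯ := pow_mem (mem_adjoin_simple_self ℚ ζ) _
  generalize ζ ^ 5 ^ t = ω at hω hmem
  have h5 := hω.pow_eq_one
  have hsum : 1 + ω + ω ^ 2 + ω ^ 3 + ω ^ 4 = 0 := by
    have := hω.geom_sum_eq_zero (by norm_num)
    simpa [Finset.sum_range_succ] using this
  have hconj : conj ω = ω ^ 4 := by
    rw [← Complex.inv_eq_conj (hω.norm'_eq_one (by norm_num))]
    exact inv_eq_of_mul_eq_one_right (by rw [← h5]; ring)
  refine ⟨-(ω ^ 2 + ω ^ 3), neg_mem (add_mem (pow_mem hmem _) (pow_mem hmem _)), ?_, ?_⟩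
  · rw [map_neg, map_add, map_pow, map_pow, hconj]
    linear_combination (-ω ^ 3 - ω ^ 2 * (ω ^ 5 + 1)) * h5
  · linear_combination hsum + (2 + ω) * h5

theorem finiteDimensional_cyclotomic (hζ : IsPrimitiveRoot ζ (5 ^ (t + 1))) :
    FiniteDimensional ℚ ℚ⟮ζ⟯ :=
  adjoin.finiteDimensional (hζ.isIntegral (by positivity)).tower_top

theorem isAbelianGalois_cyclotomic (hζ : IsPrimitiveRoot ζ (5 ^ (t + 1))) :
    IsAbelianGalois ℚ ℚ⟮ζ⟯ := by
  have hn : NeZero (5 ^ (t + 1)) := ⟨by positivity⟩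
  have hint : IsIntegral ℚ ζ := (hζ.isIntegral (by positivity)).tower_top
  have : IsCyclotomicExtension {5 ^ (t + 1)} ℚ ℚ⟮ζ⟯ := by
    change IsCyclotomicExtension {5 ^ (t + 1)} ℚ ℚ⟮ζ⟯.toSubalgebra
    rw [adjoin_simple_toSubalgebra_of_isAlgebraic hint.isAlgebraic]
    exact hζ.adjoin_isCyclotomicExtension ℚ
  exact IsCyclotomicExtension.isAbelianGalois {5 ^ (t + 1)} ℚ ℚ⟮ζ⟯

theorem exists_gal_golden (hζ : IsPrimitiveRoot ζ (5 ^ (t + 1))) {g : ℚ⟮ζ⟯} (hg : g ^ 2 = g + 1) :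
    ∃ h : Gal(ℚ⟮ζ⟯/ℚ), h g = 1 - g := by
  have := finiteDimensional_cyclotomic hζ
  have := isAbelianGalois_cyclotomic hζ
  by_contra! hcon
  have hfix : ∃ a : ℚ, algebraMap ℚ ℚ⟮ζ⟯ a = g := by
    refine (IsGalois.mem_range_algebraMap_iff_fixed _).2 fun τ => ?_
    have hτ : (τ g - g) * (τ g - (1 - g)) = 0 := by
      have : τ g ^ 2 = τ g + 1 := by rw [← map_pow, hg, map_add, map_one]
      linear_combination this - hg
    exact sub_eq_zero.1 ((mul_eq_zero.1 hτ).resolve_right (sub_ne_zero.2 (hcon τ)))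
  obtain ⟨a, rfl⟩ := hfix
  refine rat_sq_ne_add_one a ((algebraMap ℚ ℚ⟮ζ⟯).injective ?_)
  simpa using hg

theorem golden_ne_pow_five_cyclotomic (hζ : IsPrimitiveRoot ζ (5 ^ (t + 1))) {g : ℂ}
    (hgF : g ∈ ℚ⟮ζ⟯) (hgc : conj g = g) (hg : g ^ 2 = g + 1) : ∀ w ∈ ℚ⟮ζ⟯, w ^ 5 ≠ g := by
  intro w hw hwg
  have := finiteDimensional_cyclotomic hζ
  have := isAbelianGalois_cyclotomic hζ
  have hω : IsPrimitiveRoot (ζ ^ 5 ^ t) 5 := hζ.pow (by positivity) (pow_succ 5 t)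
  obtain ⟨v, hv, hvc, hvg⟩ := exists_conj_root (F := ℚ⟮ζ⟯) hω
    (pow_mem (mem_adjoin_simple_self ℚ ζ) _) hgc hw hwg
  have hg' : (⟨g, hgF⟩ : ℚ⟮ζ⟯) ^ 2 = ⟨g, hgF⟩ + 1 := Subtype.ext hg
  obtain ⟨h, hh⟩ := exists_gal_golden hζ hg'
  exact golden_ne_pow_five (w := ⟨v, hv⟩) hg' hh hvc (Subtype.ext hvg)

theorem exists_rat_pow_five_of_kummer (hζ : IsPrimitiveRoot ζ (5 ^ (t + 1))) {g l : ℂ}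
    (hgF : g ∈ ℚ⟮ζ⟯) (hgc : conj g = g) (hg : g ^ 2 = g + 1) (hlc : conj l = l)
    (hl : l ^ 5 ^ (t + 1) = g) {b : ℚ} {z : ℂ} (hz : z ∈ ℚ⟮ζ⟯⟮l⟯) (hzb : z ^ 5 = b) :
    ∃ a : ℚ, a ^ 5 = b := by
  have := finiteDimensional_cyclotomic hζ
  have := isAbelianGalois_cyclotomic hζ
  have hω : IsPrimitiveRoot (ζ ^ 5 ^ t) 5 := hζ.pow (by positivity) (pow_succ 5 t)
  have hζL : ζ ∈ ℚ⟮ζ⟯⟮l⟯ := _root_.algebraMap_mem ℚ⟮ζ⟯⟮l⟯ (AdjoinSimple.gen ℚ ζ)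
  obtain ⟨v, hv, hvc, hvb⟩ := exists_conj_root (F := ℚ⟮ζ⟯⟮l⟯) hω
    (pow_mem hζL _) (x := (b : ℂ)) (by simp) hz hzb
  have hg' : (⟨g, hgF⟩ : ℚ⟮ζ⟯) ^ 2 = ⟨g, hgF⟩ + 1 := Subtype.ext hg
  obtain ⟨h, hh⟩ := exists_gal_golden hζ hg'
  have hlint : IsIntegral ℚ⟮ζ⟯ l := by
    refine IsIntegral.of_pow (n := 5 ^ (t + 1)) (by positivity) ?_
    rw [hl]
    exact isIntegral_algebraMap (x := (⟨g, hgF⟩ : ℚ⟮ζ⟯))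
  have := adjoin.finiteDimensional hlint
  have hl0 : l ≠ 0 := by
    rintro rfl
    rw [zero_pow (by positivity)] at hl
    rw [← hl] at hg
    norm_num at hg
  have hn : IsPrimitiveRoot (AdjoinSimple.gen ℚ ζ) (5 ^ (t + 1)) :=
    IsPrimitiveRoot.of_map_of_injective (f := algebraMap ℚ⟮ζ⟯ ℂ) hζ
      (algebraMap ℚ⟮ζ⟯ ℂ).injective
  obtain ⟨k, w, hw⟩ := exists_eq_mul_pow_of_kummer (L := ℚ⟮ζ⟯⟮l⟯) (g := (⟨g, hgF⟩ : ℚ⟮ζ⟯))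
    (ρ := AdjoinSimple.gen ℚ⟮ζ⟯ l) (z := (⟨v, hv⟩ : ℚ⟮ζ⟯⟮l⟯)) (b := algebraMap ℚ ℚ⟮ζ⟯ b) hn
    (Subtype.ext hl)
    (adjoin_eq_top_of_algebra _ _ (adjoin.powerBasis hlint).adjoin_gen_eq_top)
    (fun w hw => golden_ne_pow_five_cyclotomic hζ hgF hgc hg w w.2 (congrArg Subtype.val hw))
    (Subtype.ext (by simpa using hvb))
  have hw' : v = (w : ℂ) * (l ^ 5 ^ t) ^ k := congrArg Subtype.val hw
  have hwl : (w : ℂ) = v / (l ^ 5 ^ t) ^ k := by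
    rw [hw', mul_div_cancel_right₀ _ (pow_ne_zero _ (pow_ne_zero _ hl0))]
  refine exists_rat_pow_of_mul_pow_eq (w := w) (g := ⟨g, hgF⟩) (k := k) ?_ hh ?_ ?_
  · rw [hwl, map_div₀, map_pow, map_pow, hlc, hvc]
  · linear_combination -hg'
  · apply Subtype.ext
    have h1 : ((w : ℂ) * (l ^ 5 ^ t) ^ k) ^ 5 = b := by rw [← hw', hvb]
    have h2 : (w : ℂ) ^ 5 * g ^ k = b := by
      rw [← h1, ← hl]
      ring
    simpa using h2

theorem exists_pow_eq_of_sup (K M : IntermediateField ℚ ℂ) [FiniteDimensional ℚ K]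
    [FiniteDimensional ℚ M] {x : ℂ} (hxM : x ∈ M) (hx : ∀ z ∈ M, z ^ 5 ≠ x) :
    ∃ j, 5 ^ j ≤ Module.finrank ℚ K ∧ ∃ y ∈ K ⊔ M, y ^ 5 ^ j = x ∧ ∀ z ∈ K ⊔ M, z ^ 5 ≠ y := by
  classical
  have hbound : ∀ j, (∃ y ∈ K ⊔ M, y ^ 5 ^ j = x) → 5 ^ j ≤ Module.finrank ℚ K := by
    rintro j ⟨y, hy, hyx⟩
    have hirr : Irreducible (X ^ 5 ^ j - C (⟨x, hxM⟩ : M)) :=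
      X_pow_sub_C_irreducible_of_prime_pow (by norm_num) (by norm_num) _
        fun b hb => hx b b.2 (congrArg Subtype.val hb)
    have hmin : minpoly M y = X ^ 5 ^ j - C (⟨x, hxM⟩ : M) :=
      (minpoly.eq_of_irreducible_of_monic hirr
        (by
          rw [map_sub, map_pow, aeval_X, aeval_C, sub_eq_zero]
          exact hyx)
        (monic_X_pow_sub_C _ (by positivity))).symm
    have hyint : IsIntegral M y := by
      by_contra h
      rw [minpoly.eq_zero h] at hmin
      exact hirr.ne_zero hmin.symm
    have h1 : Module.finrank M M⟮y⟯ = 5 ^ j := by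
      rw [adjoin.finrank hyint, hmin, natDegree_X_pow_sub_C]
    have h2 : Module.finrank ℚ M * Module.finrank M M⟮y⟯ = Module.finrank ℚ M⟮y⟯ :=
      Module.finrank_mul_finrank ℚ M M⟮y⟯
    have hle : M⟮y⟯.restrictScalars ℚ ≤ K ⊔ M := by
      have : extendScalars (le_sup_right : M ≤ K ⊔ M) ≥ M⟮y⟯ := by
        rw [ge_iff_le, adjoin_simple_le_iff]
        exact hy
      exact fun a ha => this ha
    have h3 : Module.finrank ℚ M⟮y⟯ ≤ Module.finrank ℚ ↥(K ⊔ M) :=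
      LinearMap.finrank_le_finrank_of_injective (f := (inclusion hle).toLinearMap)
        (inclusion_injective hle)
    have h4 := finrank_sup_le K M
    have h5 : 0 < Module.finrank ℚ M := Module.finrank_pos
    rw [h1] at h2
    refine Nat.le_of_mul_le_mul_right ?_ h5
    rw [mul_comm, h2]
    exact h3.trans h4
  have hlt : ∀ j, (∃ y ∈ K ⊔ M, y ^ 5 ^ j = x) → j ≤ Module.finrank ℚ K := fun j hj =>
    (Nat.lt_pow_self (by norm_num)).le.trans (hbound j hj)
  have hzero : ∃ y ∈ K ⊔ M, y ^ 5 ^ 0 = x := ⟨x, le_sup_right (a := K) hxM, by simp⟩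
  have hspec := Nat.findGreatest_spec (P := fun j => ∃ y ∈ K ⊔ M, y ^ 5 ^ j = x)
    (Nat.zero_le (Module.finrank ℚ K)) hzero
  obtain ⟨y, hy, hyx⟩ := id hspec
  refine ⟨_, hbound _ hspec, y, hy, hyx, fun z hz hzy => ?_⟩
  have hsucc : ∃ y ∈ K ⊔ M, y ^ 5 ^ (Nat.findGreatest (fun j => ∃ y ∈ K ⊔ M, y ^ 5 ^ j = x)
      (Module.finrank ℚ K) + 1) = x := ⟨z, hz, by rw [pow_succ', pow_mul, hzy, hyx]⟩
  have := Nat.le_findGreatest (P := fun j => ∃ y ∈ K ⊔ M, y ^ 5 ^ j = x) (hlt _ hsucc) hsucc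
  omega

theorem exists_rat_pow_eq_of_pos (b : ℚ) (hb : 0 < b) (hb1 : b ≠ 1) :
    ∃ (i : ℕ) (c : ℚ), c ^ 5 ^ i = b ∧ ∀ a : ℚ, a ^ 5 ≠ c := by
  induction hs : b.num.natAbs + b.den using Nat.strong_induction_on generalizing b with
  | _ s ih =>
    by_cases h : ∃ a : ℚ, a ^ 5 = b
    · obtain ⟨a, rfl⟩ := h
      have ha : 0 < a := (show Odd 5 by decide).pow_pos_iff.1 hb
      have ha1 : a ≠ 1 := by
        rintro rfl
        exact hb1 (one_pow 5)
      have hn : 1 ≤ a.num.natAbs := Int.natAbs_pos.2 (Rat.num_pos.2 ha).ne'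
      have hlt : a.num.natAbs + a.den < s := by
        rw [← hs, Rat.num_pow, Rat.den_pow, Int.natAbs_pow]
        have h2 : 2 ≤ a.num.natAbs ∨ 2 ≤ a.den := by
          by_contra! hcon
          have hd := a.den_pos
          have h3 : a.num = 1 := by
            have := Rat.num_pos.2 ha
            omega
          exact ha1 (by rw [← Rat.num_div_den a, h3, show a.den = 1 by omega]; norm_num)
        have hp : ∀ k : ℕ, k ≤ k ^ 5 := fun k => Nat.le_self_pow (by norm_num) k
        have hp' : ∀ k : ℕ, 2 ≤ k → k < k ^ 5 := fun k hk => lt_self_pow₀ hk (by norm_num)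
        rcases h2 with h2 | h2
        · have := hp' _ h2
          have := hp a.den
          omega
        · have := hp' _ h2
          have := hp a.num.natAbs
          omega
      obtain ⟨i, c, hc, hc'⟩ := ih _ hlt a ha ha1 rfl
      exact ⟨i + 1, c, by rw [pow_succ, pow_mul, hc], hc'⟩
    · push Not at h
      exact ⟨0, b, by simp, h⟩

open NumberField in
theorem exists_integer_root (K : IntermediateField ℚ ℂ) [FiniteDimensional ℚ K] {b : ℚ}
    (hb : 0 < b) (hb1 : b ≠ 1) :
    ∃ J : ℕ, ∀ (M : IntermediateField ℚ ℂ) [FiniteDimensional ℚ M],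
      (∀ (c : ℚ), ∀ z ∈ M, z ^ 5 = c → ∃ a : ℚ, a ^ 5 = c) →
      ∃ m ≤ J, ∃ n : ℕ, 0 < n ∧ ∃ y : 𝓞 ↥(K ⊔ M), (∀ z : ↥(K ⊔ M), z ^ 5 ≠ y) ∧
        (b.den : 𝓞 ↥(K ⊔ M)) * y ^ 5 ^ m = (n : 𝓞 ↥(K ⊔ M)) ^ 5 ^ (m + 1) * (b.num : 𝓞 ↥(K ⊔ M)) := by
  obtain ⟨i, c, hc, hc'⟩ := exists_rat_pow_eq_of_pos b hb hb1
  refine ⟨Module.finrank ℚ K + i, fun M _ hM => ?_⟩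
  have hcM : (c : ℂ) ∈ M := by
    simpa only [eq_ratCast] using M.algebraMap_mem c
  obtain ⟨j, hj, y, hy, hyc, hyn⟩ := exists_pow_eq_of_sup K M hcM (fun z hz hzc => by
    obtain ⟨a, ha⟩ := hM c z hz hzc
    exact hc' a ha)
  have hjK : j < Module.finrank ℚ K := (Nat.lt_pow_self (by norm_num)).trans_le hj
  have hn0 : (c.den : ℂ) ≠ 0 := by exact_mod_cast c.den_ne_zero
  have hcn : (c : ℂ) * c.den = c.num := by exact_mod_cast Rat.mul_den_eq_num c
  have hint : IsIntegral ℤ ((c.den : ℂ) * y) := by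
    refine IsIntegral.of_pow (n := 5 ^ j) (by positivity) ?_
    obtain ⟨s, hs⟩ := Nat.exists_eq_succ_of_ne_zero (show 5 ^ j ≠ 0 by positivity)
    rw [mul_pow, hyc, hs, pow_succ, mul_assoc, mul_comm (c.den : ℂ) (c : ℂ), hcn]
    have := isIntegral_algebraMap (R := ℤ) (A := ℂ) (x := (c.den : ℤ) ^ s * c.num)
    simpa using this
  have hint' : IsIntegral ℤ ((c.den : ℂ) ^ 5 * y) := by
    have e : (c.den : ℂ) ^ 5 * y = (algebraMap ℤ ℂ c.den) ^ 4 * (c.den * y) := by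
      rw [eq_intCast, Int.cast_natCast]
      ring
    rw [e]
    exact (isIntegral_algebraMap.pow 4).mul hint
  have hmem : (c.den : ℂ) ^ 5 * y ∈ K ⊔ M := mul_mem (pow_mem (_root_.natCast_mem _ _) _) hy
  have hint'' : IsIntegral ℤ (⟨_, hmem⟩ : ↥(K ⊔ M)) :=
    (isIntegral_algebraMap_iff (B := ℂ) (algebraMap ↥(K ⊔ M) ℂ).injective).1 hint'
  let f : 𝓞 ↥(K ⊔ M) →+* ℂ := (algebraMap ↥(K ⊔ M) ℂ).comp (algebraMap (𝓞 ↥(K ⊔ M)) ↥(K ⊔ M))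
  have hf : Function.Injective f :=
    (algebraMap ↥(K ⊔ M) ℂ).injective.comp RingOfIntegers.coe_injective
  obtain ⟨Y, hY⟩ : ∃ Y : 𝓞 ↥(K ⊔ M), f Y = (c.den : ℂ) ^ 5 * y := ⟨⟨⟨_, hmem⟩, hint''⟩, rfl⟩
  refine ⟨j + i, by omega, c.den, c.den_pos, Y, fun z hz => ?_, ?_⟩
  · refine hyn (z / c.den) (div_mem z.2 (_root_.natCast_mem _ _)) ?_
    have hz' : (z : ℂ) ^ 5 = (c.den : ℂ) ^ 5 * y := (congrArg Subtype.val hz).trans hY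
    rw [div_pow, hz', mul_div_cancel_left₀ _ (pow_ne_zero _ hn0)]
  · have hbd : (b : ℂ) * b.den = b.num := by exact_mod_cast Rat.mul_den_eq_num b
    have h1 : (y : ℂ) ^ 5 ^ (j + i) = b := by
      rw [pow_add, pow_mul, hyc, ← hc]
      push_cast
      rfl
    have h2 : (b.den : ℂ) * ((c.den : ℂ) ^ 5 * y) ^ 5 ^ (j + i) =
        (c.den : ℂ) ^ 5 ^ (j + i + 1) * b.num := by
      rw [mul_pow, h1, ← pow_mul, ← pow_succ', ← hbd]
      ring
    apply hf
    rw [map_mul, map_mul, map_pow, map_pow, map_natCast, map_natCast, map_intCast, hY]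
    exact h2

/-- The cyclotomic field of level `5 ^ (t + 1)` contains the golden ratio, which is not a fifth power
there; a rational number which is a fifth power there is a fifth power of a rational number. -/
theorem exists_cyclotomic_field (t : ℕ) :
    ∃ (F : IntermediateField ℚ ℂ) (_ : FiniteDimensional ℚ F) (ζ g : ℂ),
      IsPrimitiveRoot ζ (5 ^ (t + 1)) ∧ ζ ∈ F ∧ g ∈ F ∧ g ^ 2 = g + 1 ∧ (∀ z ∈ F, z ^ 5 ≠ g) ∧
      ∀ (c : ℚ), ∀ z ∈ F, z ^ 5 = c → ∃ a : ℚ, a ^ 5 = c := by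
  have hζ := Complex.isPrimitiveRoot_exp (5 ^ (t + 1)) (by positivity)
  generalize Complex.exp (2 * Real.pi * Complex.I / (5 ^ (t + 1) : ℕ)) = ζ at hζ
  obtain ⟨g, hgF, hgc, hg⟩ := exists_golden hζ
  have hfd := finiteDimensional_cyclotomic hζ
  obtain ⟨r, hr⟩ := Complex.conj_eq_iff_real.1 hgc
  obtain ⟨l, hl⟩ := exists_real_pow_eq r (show Odd (5 ^ (t + 1)) from Odd.pow (by decide))
  have hl' : (l : ℂ) ^ 5 ^ (t + 1) = g := by
    rw [hr, ← hl]
    push_cast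
    rfl
  refine ⟨ℚ⟮ζ⟯, hfd, ζ, g, hζ, mem_adjoin_simple_self ℚ ζ, hgF, hg,
    golden_ne_pow_five_cyclotomic hζ hgF hgc hg, fun c z hz hzc => ?_⟩
  exact exists_rat_pow_five_of_kummer hζ hgF hgc hg (Complex.conj_ofReal l) hl'
    (_root_.algebraMap_mem ℚ⟮ζ⟯⟮(l : ℂ)⟯ (⟨z, hz⟩ : ℚ⟮ζ⟯)) hzc

/-- There is a number field containing the roots of unity of order `5 ^ (t + 1)` in which the golden
ratio is a `5 ^ (t + 1)`-th power, but no new rational number becomes a fifth power. -/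
theorem exists_kummer_field (t : ℕ) :
    ∃ (M : IntermediateField ℚ ℂ) (_ : FiniteDimensional ℚ M) (ζ l : ℂ),
      IsPrimitiveRoot ζ (5 ^ (t + 1)) ∧ ζ ∈ M ∧ l ∈ M ∧
      (l ^ 5 ^ (t + 1)) ^ 2 = l ^ 5 ^ (t + 1) + 1 ∧
      ∀ (c : ℚ), ∀ z ∈ M, z ^ 5 = c → ∃ a : ℚ, a ^ 5 = c := by
  have hζ := Complex.isPrimitiveRoot_exp (5 ^ (t + 1)) (by positivity)
  generalize Complex.exp (2 * Real.pi * Complex.I / (5 ^ (t + 1) : ℕ)) = ζ at hζ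
  obtain ⟨g, hgF, hgc, hg⟩ := exists_golden hζ
  have hfd := finiteDimensional_cyclotomic hζ
  obtain ⟨r, hr⟩ := Complex.conj_eq_iff_real.1 hgc
  obtain ⟨l, hl⟩ := exists_real_pow_eq r (show Odd (5 ^ (t + 1)) from Odd.pow (by decide))
  have hl' : (l : ℂ) ^ 5 ^ (t + 1) = g := by
    rw [hr, ← hl]
    push_cast
    rfl
  have hlint : IsIntegral ℚ⟮ζ⟯ (l : ℂ) := by
    refine IsIntegral.of_pow (n := 5 ^ (t + 1)) (by positivity) ?_
    rw [hl']
    exact isIntegral_algebraMap (x := (⟨g, hgF⟩ : ℚ⟮ζ⟯))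
  have := adjoin.finiteDimensional hlint
  have hfd' : FiniteDimensional ℚ ℚ⟮ζ⟯⟮(l : ℂ)⟯ := FiniteDimensional.trans ℚ ℚ⟮ζ⟯ _
  refine ⟨ℚ⟮ζ⟯⟮(l : ℂ)⟯.restrictScalars ℚ, hfd', ζ, l, hζ,
    _root_.algebraMap_mem ℚ⟮ζ⟯⟮(l : ℂ)⟯ (AdjoinSimple.gen ℚ ζ),
    mem_adjoin_simple_self ℚ⟮ζ⟯ (l : ℂ), by rw [hl', hg], fun c z hz hzc => ?_⟩
  exact exists_rat_pow_five_of_kummer hζ hgF hgc hg (Complex.conj_ofReal l) hl' hz hzc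

end KummerFields

section Recurrence

open Polynomial NumberField

/-- The linear functional `X ^ n ↦ v n` on polynomials. -/
noncomputable def seqEval {R : Type*} [CommRing R] (v : ℕ → R) : R[X] →ₗ[R] R :=
  Polynomial.lsum fun n => (LinearMap.toSpanSingleton R R (v n))

theorem seqEval_monomial {R : Type*} [CommRing R] (v : ℕ → R) (n : ℕ) (a : R) :
    seqEval v (monomial n a) = a * v n := by
  simp [seqEval, Polynomial.lsum_apply, Polynomial.sum_monomial_index]

theorem seqEval_X_pow {R : Type*} [CommRing R] (v : ℕ → R) (n : ℕ) :
    seqEval v (X ^ n) = v n := by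
  rw [← monomial_one_right_eq_X_pow, seqEval_monomial, one_mul]

theorem seqEval_map {R S : Type*} [CommRing R] [CommRing S] (f : R →+* S) (v : ℕ → R) (P : R[X]) :
    seqEval (fun n => f (v n)) (P.map f) = f (seqEval v P) := by
  induction P using Polynomial.induction_on' with
  | add P Q hP hQ => rw [Polynomial.map_add, map_add, hP, hQ, map_add, map_add]
  | monomial n a => rw [map_monomial, seqEval_monomial, seqEval_monomial, map_mul]

/-- The characteristic polynomial of a linear recurrence. -/
noncomputable def recPoly {R : Type*} [CommRing R] {k : ℕ} (c : Fin k → R) : R[X] :=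
  X ^ k - ∑ i : Fin k, C (c i) * X ^ (k - 1 - (i : ℕ))

theorem recPoly_map {R S : Type*} [CommRing R] [CommRing S] {k : ℕ} (f : R →+* S) (c : Fin k → R) :
    (recPoly c).map f = recPoly fun i => f (c i) := by
  simp [recPoly, Polynomial.map_sub, Polynomial.map_sum]

theorem recPoly_monic {R : Type*} [CommRing R] [Nontrivial R] {k : ℕ} (c : Fin k → R) :
    (recPoly c).Monic := by
  refine monic_X_pow_sub ?_
  refine (degree_sum_le _ _).trans_lt ?_
  refine (Finset.sup_lt_iff (WithBot.bot_lt_coe k)).2 fun i _ => ?_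
  refine (degree_C_mul_X_pow_le _ _).trans_lt ?_
  exact Nat.cast_lt.2 (by omega)

theorem seqEval_recPoly_mul {R : Type*} [CommRing R] {k : ℕ} {c : Fin k → R}
    {v : ℕ → R} (h : ∀ n, v (n + k) = ∑ i : Fin k, c i * v (n + k - 1 - (i : ℕ))) (P : R[X]) :
    seqEval v (recPoly c * P) = 0 := by
  induction P using Polynomial.induction_on' with
  | add P Q hP hQ => rw [mul_add, map_add, hP, hQ, add_zero]
  | monomial n a =>
    have e : recPoly c * monomial n a =
        monomial (n + k) a - ∑ i : Fin k, monomial (n + k - 1 - (i : ℕ)) (a * c i) := by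
      rw [recPoly, sub_mul, Finset.sum_mul, X_pow_eq_monomial, monomial_mul_monomial, one_mul,
        add_comm]
      congr 1
      refine Finset.sum_congr rfl fun i _ => ?_
      rw [C_mul_X_pow_eq_monomial, monomial_mul_monomial, mul_comm,
        show k - 1 - (i : ℕ) + n = n + k - 1 - (i : ℕ) by omega]
    rw [e, map_sub, map_sum, seqEval_monomial, h, Finset.mul_sum, sub_eq_zero]
    refine Finset.sum_congr rfl fun i _ => ?_
    rw [seqEval_monomial, mul_assoc]

theorem exists_newton_root {χ : ℚ[X]} (hχ : χ.Monic) :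
    ∃ (w P : ℚ[X]) (K : ℕ), P.Monic ∧ P.Separable ∧ P ∣ χ ∧ χ ∣ (X - w) ^ K ∧ χ ∣ P.comp w := by
  classical
  have hχ0 := hχ.ne_zero
  set P := UniqueFactorizationMonoid.radical χ with hP
  have hP0 : P ≠ 0 := UniqueFactorizationMonoid.radical_ne_zero
  have hsq : Squarefree P := UniqueFactorizationMonoid.squarefree_radical
  have hsep : P.Separable := PerfectField.separable_iff_squarefree.2 hsq
  obtain ⟨n, hn⟩ := UniqueFactorizationMonoid.exists_dvd_radical_self_pow hχ0
  have hroot : ∀ Q : ℚ[X], aeval (AdjoinRoot.root χ) Q = 0 ↔ χ ∣ Q := fun Q => by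
    rw [AdjoinRoot.aeval_eq, AdjoinRoot.mk_eq_zero]
  have nil : IsNilpotent (aeval (AdjoinRoot.root χ) P) :=
    ⟨n, by rw [← map_pow]; exact (hroot _).2 hn⟩
  have uni : IsUnit (aeval (AdjoinRoot.root χ) (derivative P)) := by
    obtain ⟨a, b, h⟩ : IsCoprime (P ^ n) (derivative P) := hsep.pow_left
    have h2 := congrArg (aeval (AdjoinRoot.root χ)) h
    rw [map_add, map_mul, (hroot (P ^ n)).2 hn, mul_zero, zero_add, map_mul, map_one] at h2
    exact IsUnit.of_mul_eq_one_right _ h2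
  obtain ⟨r, ⟨⟨K, hK⟩, hr⟩, -⟩ := existsUnique_nilpotent_sub_and_aeval_eq_zero nil uni
  obtain ⟨w, rfl⟩ := AdjoinRoot.mk_surjective r
  refine ⟨w, P * C P.leadingCoeff⁻¹, K, monic_mul_leadingCoeff_inv hP0,
    hsep.mul_unit ?_, ?_, ?_, ?_⟩
  · exact (isUnit_C.2 (isUnit_iff_ne_zero.2 (inv_ne_zero (leadingCoeff_ne_zero.2 hP0))))
  · obtain ⟨Q, hQ⟩ := UniqueFactorizationMonoid.radical_dvd_self (a := χ)
    refine ⟨C P.leadingCoeff * Q, ?_⟩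
    rw [mul_assoc, ← mul_assoc (C _), ← C_mul, inv_mul_cancel₀ (leadingCoeff_ne_zero.2 hP0), C_1,
      one_mul, ← hQ]
  · rw [← AdjoinRoot.mk_eq_zero, map_pow, map_sub, AdjoinRoot.mk_X, hK]
  · rw [mul_comp]
    refine dvd_mul_of_dvd_left ?_ _
    rw [← AdjoinRoot.mk_eq_zero, ← hr, comp, hom_eval₂]
    rfl

theorem dvd_X_pow_sub {p : ℕ} [Fact p.Prime] {χ w : (ZMod p)[X]} {K : ℕ} (hK : K ≤ p)
    (h₁ : χ ∣ (X - w) ^ K) (s : Finset (ZMod p)) (h₂ : χ ∣ ∏ a ∈ s, (w - C a)) :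
    χ ∣ X ^ p - w := by
  have e1 : χ ∣ X ^ p - w ^ p := by
    rw [← sub_pow_char]
    exact h₁.trans (pow_dvd_pow _ hK)
  have e2 : χ ∣ w ^ p - w := by
    have h3 : ∏ a ∈ s, (X - C a) ∣ (X ^ p - X : (ZMod p)[X]) := by
      refine (Finset.prod_dvd_prod_of_subset _ _ _ (Finset.subset_univ s)).trans ?_
      have := prod_multiset_X_sub_C_dvd (X ^ p - X : (ZMod p)[X])
      have e := FiniteField.roots_X_pow_card_sub_X (ZMod p)
      rw [ZMod.card] at e
      rwa [e] at this
    have h4 := _root_.map_dvd (compRingHom w) h3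
    rw [map_prod] at h4
    simp only [coe_compRingHom, sub_comp, X_comp, C_comp, pow_comp] at h4
    exact h₂.trans h4
  have := dvd_add e1 e2
  rwa [sub_add_sub_cancel] at this

end Recurrence

section Reduction

open Polynomial NumberField

/-- A finite set of elements of a number field lies in a subring to which the reductions modulo
almost all primes extend. -/
theorem exists_subring_reduction {E : Type*} [Field E] [NumberField E] (s : Finset E) :
    ∃ N : ℕ, ∀ p : ℕ, p.Prime → N < p → ∀ _ : 𝓞 E →+* ZMod p,
      ∃ (C : Subring E) (_ : C →+* ZMod p), ∀ x ∈ s, x ∈ C := by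
  classical
  have key : ∀ x : E, ∃ d : ℕ, 0 < d ∧ ∃ a : 𝓞 E, (d : E) * x = algebraMap (𝓞 E) E a := by
    intro x
    obtain ⟨⟨a, ⟨d, hd⟩⟩, h⟩ := IsLocalization.surj (Algebra.algebraMapSubmonoid (𝓞 E) (nonZeroDivisors ℤ)) x
    obtain ⟨e, he, rfl⟩ := hd
    have he0 : e ≠ 0 := nonZeroDivisors.ne_zero he
    refine ⟨e.natAbs, Int.natAbs_pos.2 he0, ?_⟩
    have h' : x * (e : E) = algebraMap (𝓞 E) E a := by simpa using h
    rcases Int.natAbs_eq e with h1 | h1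
    · refine ⟨a, ?_⟩
      rw [← h', h1]
      push_cast
      simp [mul_comm]
    · refine ⟨-a, ?_⟩
      rw [map_neg, ← h', h1]
      push_cast
      simp [mul_comm]
  choose d hd a ha using key
  refine ⟨∑ x ∈ s, d x, fun p hp hNp ψ => ?_⟩
  have := Fact.mk hp
  have hprime : (RingHom.ker ψ).IsPrime := RingHom.ker_isPrime ψ
  have hψ : ∀ y : (RingHom.ker ψ).primeCompl, IsUnit (ψ y) := fun y => isUnit_iff_ne_zero.2 y.2
  let L := Localization.AtPrime (RingHom.ker ψ)
  have hle : (RingHom.ker ψ).primeCompl ≤ nonZeroDivisors (𝓞 E) :=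
    Ideal.primeCompl_le_nonZeroDivisors _
  have hj : ∀ y : (RingHom.ker ψ).primeCompl, IsUnit (algebraMap (𝓞 E) E y) := fun y =>
    isUnit_iff_ne_zero.2 (RingOfIntegers.coe_ne_zero_iff.2 (nonZeroDivisors.ne_zero (hle y.2)))
  let j : L →+* E := IsLocalization.lift hj
  let Φ : L →+* ZMod p := IsLocalization.lift hψ
  have hjinj : Function.Injective j := by
    refine (IsLocalization.lift_injective_iff hj).2 fun x y => ?_
    rw [(IsLocalization.injective L hle).eq_iff, RingOfIntegers.coe_injective.eq_iff]
  refine ⟨j.range, Φ.comp (RingEquiv.ofLeftInverse (Function.leftInverse_invFun hjinj)).symm.toRingHom,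
    fun x hx => ?_⟩
  have hdp : d x < p := (Finset.single_le_sum (f := d) (fun _ _ => Nat.zero_le _) hx).trans_lt hNp
  have hdm : (d x : 𝓞 E) ∈ (RingHom.ker ψ).primeCompl := by
    intro h
    have h2 : ψ (d x : 𝓞 E) = 0 := h
    rw [map_natCast, ZMod.natCast_eq_zero_iff] at h2
    exact absurd (Nat.le_of_dvd (hd x) h2) (by omega)
  refine ⟨IsLocalization.mk' L (a x) ⟨_, hdm⟩, ?_⟩
  refine (IsLocalization.lift_mk'_spec hj _ _ _).2 ?_
  rw [← ha x]
  simp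

theorem exists_lift {E : Type*} [Field E] {C : Subring E} {f : E[X]} (h : ∀ x ∈ f.coeffs, x ∈ C) :
    ∃ g : C[X], g.map C.subtype = f := by
  rw [← mem_lifts, lifts_iff_coeff_lifts]
  intro n
  by_cases hn : f.coeff n = 0
  · exact ⟨0, by simp [hn]⟩
  · exact ⟨⟨_, h _ (coeff_mem_coeffs hn)⟩, rfl⟩

theorem ratCast_reduction {E : Type*} [Field E] [CharZero E] {p : ℕ} [Fact p.Prime] {C : Subring E} (Φ : C →+* ZMod p) {y : C} {r : ℚ}
    (h : (y : E) = r) : Φ y * r.den = r.num := by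
  have h2 : y * (r.den : C) = (r.num : C) := by
    apply Subtype.ext
    push_cast
    rw [h]
    exact_mod_cast congrArg (Rat.cast : ℚ → E) (Rat.mul_den_eq_num r)
  have := congrArg Φ h2
  rwa [map_mul, map_natCast, map_intCast] at this

end Reduction

section RecurrenceReduction

open Polynomial NumberField

theorem exists_rat_of_recurrence {k : ℕ} {c : Fin k → ℚ} {u : ℕ → ℚ}
    (hrec : ∀ n, u (n + k) = ∑ i : Fin k, c i * u (n + k - 1 - (i : ℕ))) :
    ∃ (r : ℚ) (χ : ℚ[X]), ∀ (E : Type) [Field E] [NumberField E],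
      (χ.map (algebraMap ℚ E)).Splits →
      ∃ N : ℕ, ∀ p : ℕ, p.Prime → N < p → ∀ _ : 𝓞 E →+* ZMod p, (u p).den.Coprime p →
        ((u p).num : ZMod p) * ((u p).den : ZMod p)⁻¹ = r.num * (r.den : ZMod p)⁻¹ := by
  classical
  obtain ⟨w, P, K, hPm, hPs, hPχ, hχ₁, hχ₂⟩ := exists_newton_root (recPoly_monic c)
  refine ⟨seqEval u w, recPoly c, fun E _ _ hsplit => ?_⟩
  let f : ℚ →+* E := algebraMap ℚ E
  let σ : Finset E := (P.map f).roots.toFinset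
  have hPσ : P.map f = ∏ α ∈ σ, (X - C α) := by
    have h1 : (P.map f).Splits := hsplit.of_dvd
      (Polynomial.map_ne_zero (recPoly_monic c).ne_zero) (Polynomial.map_dvd _ hPχ)
    have h2 : (P.map f).roots.Nodup := nodup_roots (hPs.map)
    have h3 := h1.eq_prod_roots_of_monic (hPm.map f)
    rwa [Finset.prod, Multiset.toFinset_val, h2.dedup]
  obtain ⟨A, hA⟩ : (recPoly c).map f ∣ ∏ α ∈ σ, (w.map f - C α) := by
    have h1 := Polynomial.map_dvd f hχ₂
    rw [Polynomial.map_comp, hPσ, prod_comp] at h1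
    simpa only [sub_comp, X_comp, C_comp] using h1
  obtain ⟨B, hB⟩ : (recPoly c).map f ∣ (X - w.map f) ^ K := by
    have h1 := Polynomial.map_dvd f hχ₁
    rwa [Polynomial.map_pow, Polynomial.map_sub, map_X] at h1
  obtain ⟨N, hN⟩ := exists_subring_reduction ((w.map f).coeffs ∪ A.coeffs ∪ B.coeffs ∪ σ ∪
    Finset.univ.image (fun i => f (c i)) ∪ (Finset.range k).image (fun n => f (u n)) ∪
    Finset.image₂ (fun α β => (α - β)⁻¹) σ σ)
  refine ⟨N + K + (seqEval u w).den, fun p hp hNp ψ hden => ?_⟩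
  have := Fact.mk hp
  obtain ⟨S, Φ, hS⟩ := hN p hp (by omega) ψ
  obtain ⟨w', hw'⟩ := exists_lift (C := S) (f := w.map f) fun x hx => hS x (by simp [hx])
  obtain ⟨A', hA'⟩ := exists_lift (C := S) (f := A) fun x hx => hS x (by simp [hx])
  obtain ⟨B', hB'⟩ := exists_lift (C := S) (f := B) fun x hx => hS x (by simp [hx])
  have hσS : ∀ α ∈ σ, α ∈ S := fun x hx => hS x (by simp [hx])
  have hcS : ∀ i, f (c i) ∈ S := fun i => hS _ (by simp)
  have hinv : ∀ α ∈ σ, ∀ β ∈ σ, (α - β)⁻¹ ∈ S := fun α hα β hβ => hS _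
    (Finset.mem_union_right _ (Finset.mem_image₂_of_mem hα hβ))
  have huS : ∀ n, f (u n) ∈ S := by
    intro n
    induction n using Nat.strong_induction_on with
    | _ n ih =>
      rcases lt_or_ge n k with h | h
      · refine hS _ (Finset.mem_union_left _ (Finset.mem_union_right _ ?_))
        exact Finset.mem_image_of_mem _ (Finset.mem_range.2 h)
      · obtain ⟨m, rfl⟩ := Nat.exists_eq_add_of_le' h
        rw [hrec, map_sum]
        refine sum_mem fun i _ => ?_
        rw [map_mul]
        exact mul_mem (hcS i) (ih _ (by omega))
  let c' : Fin k → S := fun i => ⟨_, hcS i⟩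
  let v : ℕ → S := fun n => ⟨_, huS n⟩
  have hv : ∀ n, v (n + k) = ∑ i : Fin k, c' i * v (n + k - 1 - (i : ℕ)) := by
    intro n
    apply S.subtype_injective
    rw [map_sum]
    simp only [map_mul]
    have := congrArg f (hrec n)
    rw [map_sum] at this
    simp only [map_mul] at this
    exact this
  have hinj : Function.Injective (Polynomial.map S.subtype) :=
    Polynomial.map_injective _ S.subtype_injective
  have hχ' : (recPoly c').map S.subtype = (recPoly c).map f := by
    rw [recPoly_map, recPoly_map]
    rfl
  have hAS : ∏ α ∈ σ.attach, (w' - C (⟨α, hσS _ α.2⟩ : S)) = recPoly c' * A' := by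
    apply hinj
    rw [Polynomial.map_mul, hχ', hA', ← hA, Polynomial.map_prod, ← Finset.prod_attach σ]
    refine Finset.prod_congr rfl fun α _ => ?_
    rw [Polynomial.map_sub, hw', map_C]
    rfl
  have hBS : (X - w') ^ K = recPoly c' * B' := by
    apply hinj
    rw [Polynomial.map_mul, hχ', hB', ← hB, Polynomial.map_pow, Polynomial.map_sub, hw', map_X]
  have hd₁ : (recPoly c').map Φ ∣ (X - w'.map Φ) ^ K := by
    refine ⟨B'.map Φ, ?_⟩
    rw [← Polynomial.map_mul, ← hBS, Polynomial.map_pow, Polynomial.map_sub, map_X]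
  have hd₂ : (recPoly c').map Φ ∣
      ∏ a ∈ σ.attach.image (fun α : σ => Φ ⟨α, hσS _ α.2⟩), (w'.map Φ - C a) := by
    refine ⟨A'.map Φ, ?_⟩
    rw [← Polynomial.map_mul, ← hAS, Polynomial.map_prod, Finset.prod_image]
    · refine Finset.prod_congr rfl fun α _ => ?_
      rw [Polynomial.map_sub, map_C]
    · intro α _ β _ hαβ
      by_contra hne
      have hne' : (α : E) - β ≠ 0 := sub_ne_zero.2 fun h => hne (Subtype.ext h)
      have h1 : ((⟨α, hσS _ α.2⟩ : S) - ⟨β, hσS _ β.2⟩) * ⟨_, hinv _ α.2 _ β.2⟩ = 1 :=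
        Subtype.ext (mul_inv_cancel₀ hne')
      have h2 := congrArg Φ h1
      have h3 : Φ (⟨α, hσS _ α.2⟩ : S) = Φ ⟨β, hσS _ β.2⟩ := hαβ
      rw [map_mul, map_sub, h3, sub_self, zero_mul, map_one] at h2
      exact zero_ne_one h2
  obtain ⟨G, hG⟩ := dvd_X_pow_sub (by omega) hd₁ _ hd₂
  have hΦv : ∀ n, Φ (v (n + k)) = ∑ i : Fin k, Φ (c' i) * Φ (v (n + k - 1 - (i : ℕ))) := by
    intro n
    rw [hv, map_sum]
    simp only [map_mul]
  have hmain : Φ (v p) = Φ (seqEval v w') := by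
    have h1 := seqEval_recPoly_mul (v := fun n => Φ (v n)) (c := fun i => Φ (c' i)) hΦv G
    rw [← recPoly_map, ← hG, map_sub, seqEval_X_pow, seqEval_map] at h1
    exact sub_eq_zero.1 h1
  have hr : ((seqEval v w' : S) : E) = (seqEval u w : ℚ) := by
    have h1 := seqEval_map S.subtype v w'
    rw [hw'] at h1
    have h2 := seqEval_map f u w
    rw [← eq_ratCast (algebraMap ℚ E)]
    exact h1.symm.trans h2
  have hu : ((v p : S) : E) = (u p : ℚ) := eq_ratCast f _
  have e1 := ratCast_reduction Φ hr
  have e2 := ratCast_reduction Φ hu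
  have n1 : ((seqEval u w).den : ZMod p) ≠ 0 := by
    rw [Ne, ZMod.natCast_eq_zero_iff]
    intro h
    exact absurd (Nat.le_of_dvd (seqEval u w).den_pos h) (by omega)
  have n2 : ((u p).den : ZMod p) ≠ 0 := by
    rw [Ne, ZMod.natCast_eq_zero_iff]
    intro h
    exact hp.one_lt.ne' (Nat.dvd_one.1 (hden ▸ Nat.dvd_gcd h dvd_rfl))
  rw [← e1, ← e2, mul_inv_cancel_right₀ n1, mul_inv_cancel_right₀ n2, hmain]

end RecurrenceReduction

section PrimeField

variable {p : ℕ} [Fact p.Prime]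

theorem qFib_cast_eq_schurFib (q : ℤ) (n : ℕ) :
    ((qFib q n : ℤ) : ZMod p) = schurFib (q : ZMod p) n := by
  induction n using Nat.strong_induction_on with
  | _ n ih =>
    match n with
    | 0 => simp [qFib, schurFib]
    | 1 => simp [qFib, schurFib]
    | n + 2 =>
      rw [qFib, schurFib, ← ih n (by omega), ← ih (n + 1) (by omega)]
      push_cast
      rfl

theorem exists_qFib_eq_pow {q : ℤ} (hq : (q : ZMod p) ≠ 0) (h5 : 5 ∣ orderOf (q : ZMod p)) :
    ∃ (s : ZMod p) (I : ℕ), s ^ 2 = s + 1 ∧ I * orderOf (q : ZMod p) = p - 1 ∧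
      ((qFib q p : ℤ) : ZMod p) = s ^ I := by
  have hp : p.Prime := Fact.out
  obtain ⟨m, hm⟩ := h5
  obtain ⟨I, hI⟩ := ZMod.orderOf_dvd_card_sub_one hq
  have hm0 : 0 < m := by
    rcases Nat.eq_zero_or_pos m with rfl | h
    · have h2 := hp.two_le
      rw [hm] at hI
      omega
    · exact h
  obtain ⟨s, hs, h⟩ := exists_schurFib_eq_pow hm0 (hm ▸ IsPrimitiveRoot.orderOf (q : ZMod p))
  refine ⟨s, I, hs, by rw [hI, mul_comm], ?_⟩
  rw [qFib_cast_eq_schurFib, ← h I, ← hm, mul_comm, ← hI, Nat.sub_add_cancel hp.one_le]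

theorem exists_pow_five_eq {n : ℕ} (hn : p - 1 = 5 * n) {x : ZMod p} (hx : x ≠ 0)
    (h : x ^ (2 * n) = 1) : ∃ w, w ^ 5 = x := by
  have hp : p.Prime := Fact.out
  have hn0 : 0 < n := by
    have := hp.two_le
    omega
  obtain ⟨g, hg⟩ := IsCyclic.exists_generator (α := (ZMod p)ˣ)
  have hog : orderOf g = 5 * n := by
    rw [orderOf_eq_card_of_forall_mem_zpowers hg, Nat.card_eq_fintype_card, ZMod.card_units, hn]
  obtain ⟨a, ha⟩ := (mem_powers_iff_mem_zpowers.2 (hg (Units.mk0 x hx)))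
  have ha' : g ^ a = Units.mk0 x hx := ha
  have h1 : g ^ (a * (2 * n)) = 1 := by
    rw [pow_mul, ha']
    exact Units.ext (by simpa using h)
  have h2 := orderOf_dvd_of_pow_eq_one h1
  rw [hog, show a * (2 * n) = (a * 2) * n by ring] at h2
  have h3 : 5 ∣ a := (Nat.Coprime.dvd_of_dvd_mul_right (by norm_num : Nat.Coprime 5 2))
    (Nat.dvd_of_mul_dvd_mul_right hn0 h2)
  obtain ⟨b, rfl⟩ := h3
  refine ⟨(g ^ b : (ZMod p)ˣ), ?_⟩
  have := congrArg (Units.val) ha'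
  rw [mul_comm, pow_mul] at this
  simpa using this

theorem pow_ne_one_of_root {m e : ℕ} (hp1 : p - 1 = 5 ^ (m + 1) * e) {a b n y : ZMod p}
    (ha : a ≠ 0) (hy : ∀ w, w ^ 5 ≠ y) (h : a * y ^ 5 ^ m = n ^ 5 ^ (m + 1) * b) :
    (b / a) ^ (2 * e) ≠ 1 := by
  intro hba
  have hy0 : y ≠ 0 := fun h0 => hy 0 (by rw [h0]; norm_num)
  have hn0 : n ≠ 0 := by
    rintro rfl
    rw [zero_pow (by positivity), zero_mul] at h
    exact mul_ne_zero ha (pow_ne_zero _ hy0) h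
  have h1 : y ^ 5 ^ m = n ^ 5 ^ (m + 1) * (b / a) := by
    field_simp
    linear_combination h
  obtain ⟨w, hw⟩ := exists_pow_five_eq (n := 5 ^ m * e) (by rw [hp1]; ring) hy0 (by
    rw [show 2 * (5 ^ m * e) = 5 ^ m * (2 * e) by ring, pow_mul, h1, mul_pow, hba, ← pow_mul,
      show 5 ^ (m + 1) * (2 * e) = (p - 1) * 2 by rw [hp1]; ring, pow_mul,
      ZMod.pow_card_sub_one_eq_one hn0]
    simp)
  exact hy w hw

theorem pow_eq_one_of_golden {s γ : ZMod p} (hs : s ^ 2 = s + 1) (hγ : γ ^ 2 = γ + 1) {e : ℕ}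
    (h : s ^ (2 * e) = 1) : γ ^ (2 * e) = 1 := by
  have h0 : (s - γ) * (s + γ - 1) = 0 := by linear_combination hs - hγ
  rcases mul_eq_zero.1 h0 with h1 | h1
  · rwa [← sub_eq_zero.1 h1]
  · have h2 : (s ^ 2) * γ ^ 2 = 1 := by
      have : s = 1 - γ := by linear_combination h1
      rw [this]
      linear_combination (γ ^ 2 - γ + 1) * hγ
    have h3 := congrArg (· ^ e) h2
    simp only [mul_pow, ← pow_mul, one_pow, h, one_mul] at h3
    exact h3

theorem not_dvd_of_pow_ne_one {q : ZMod p} {m e I : ℕ} (hp1 : p - 1 = 5 ^ (m + 1) * e)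
    (hI : I * orderOf q = p - 1) (h : q ^ e ≠ 1) : ¬ 5 ^ (m + 1) ∣ I := by
  rintro ⟨J, rfl⟩
  apply h
  rw [hp1, mul_assoc] at hI
  rw [← Nat.eq_of_mul_eq_mul_left (by positivity) hI, mul_comm, pow_mul, pow_orderOf_eq_one, one_pow]

theorem five_dvd_orderOf {q : ZMod p} (hq : q ≠ 0) {m e : ℕ} (hp1 : p - 1 = 5 ^ (m + 1) * e)
    (h : q ^ e ≠ 1) : 5 ∣ orderOf q := by
  by_contra h5
  have h1 := ZMod.orderOf_dvd_card_sub_one hq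
  rw [hp1] at h1
  have h2 : Nat.Coprime (orderOf q) (5 ^ (m + 1)) :=
    (((Nat.Prime.coprime_iff_not_dvd (by norm_num)).2 h5).symm).pow_right _
  exact h (orderOf_dvd_iff_pow_eq_one.1 (h2.dvd_of_dvd_mul_left h1))

theorem dvd_pow_mul_of_not_dvd {I m a c : ℕ} (h : I ∣ 5 ^ a * c) (hI : ¬ 5 ^ (m + 1) ∣ I) :
    I ∣ 5 ^ m * c := by
  have hI0 : I ≠ 0 := by
    rintro rfl
    exact hI (dvd_zero _)
  obtain ⟨i, I₀, h5, rfl⟩ := Nat.exists_eq_pow_mul_and_not_dvd hI0 5 (by norm_num)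
  have him : i ≤ m := by
    by_contra hlt
    exact hI ((pow_dvd_pow 5 (by omega)).trans (dvd_mul_right _ _))
  refine mul_dvd_mul (pow_dvd_pow 5 him) ?_
  have hcop : Nat.Coprime I₀ (5 ^ a) :=
    (((Nat.Prime.coprime_iff_not_dvd (by norm_num)).2 h5).symm).pow_right _
  exact hcop.dvd_of_dvd_mul_left ((dvd_mul_left _ _).trans h)

end PrimeField

section Assembly

open Polynomial NumberField

/-- The embedding of the ring of integers of a subfield of `ℂ` into `ℂ`. -/
noncomputable def integersToComplex (L : IntermediateField ℚ ℂ) : 𝓞 L →+* ℂ :=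
  (algebraMap L ℂ).comp (algebraMap (𝓞 L) L)

theorem integersToComplex_injective (L : IntermediateField ℚ ℂ) :
    Function.Injective (integersToComplex L) :=
  (algebraMap L ℂ).injective.comp RingOfIntegers.coe_injective

theorem exists_integersToComplex_eq {L : IntermediateField ℚ ℂ} {z : ℂ} (hz : z ∈ L)
    (h : IsIntegral ℤ z) : ∃ y : 𝓞 L, integersToComplex L y = z :=
  ⟨⟨⟨z, hz⟩, (isIntegral_algebraMap_iff (B := ℂ) (algebraMap L ℂ).injective).1 h⟩, rfl⟩

theorem isIntegral_of_sq_eq_add_one {g : ℂ} (hg : g ^ 2 = g + 1) : IsIntegral ℤ g := by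
  refine ⟨X ^ 2 - X - 1, by monicity!, ?_⟩
  simp [hg]

theorem numberField_of_finiteDimensional (L : IntermediateField ℚ ℂ) [FiniteDimensional ℚ L] :
    NumberField L where
  to_charZero := inferInstance
  to_finiteDimensional := by
    convert ‹FiniteDimensional ℚ L›

theorem exists_splitting_field (χ : ℚ[X]) :
    ∃ (K : IntermediateField ℚ ℂ) (_ : FiniteDimensional ℚ K),
      ∀ L : IntermediateField ℚ ℂ, K ≤ L → ∀ f : ℚ →+* L, (χ.map f).Splits := by
  let σ : χ.SplittingField →ₐ[ℚ] ℂ := IsAlgClosed.lift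
  refine ⟨σ.fieldRange, LinearMap.finiteDimensional_range σ.toLinearMap, fun L hL f => ?_⟩
  have h := (SplittingField.splits χ).map
    ((IntermediateField.inclusion hL).toRingHom.comp σ.rangeRestrict.toRingHom)
  rw [Polynomial.map_map] at h
  exact (RingHom.ext_rat f (RingHom.comp _ (algebraMap ℚ χ.SplittingField))) ▸ h

theorem exists_prime_cyclotomic {E : Type} [Field E] [NumberField E] {t : ℕ} {ζ : 𝓞 E}
    (hζ : IsPrimitiveRoot ζ (5 ^ (t + 1))) {y₁ y₂ : 𝓞 E} (h₁ : ∀ z : E, z ^ 5 ≠ y₁)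
    (h₂ : ∀ z : E, z ^ 5 ≠ y₂) (N : ℕ) :
    ∃ p, p.Prime ∧ N < p ∧ 5 ^ (t + 1) ∣ p - 1 ∧ ∃ ψ : 𝓞 E →+* ZMod p,
      (∀ w, w ^ 5 ≠ ψ y₁) ∧ ∀ w, w ^ 5 ≠ ψ y₂ := by
  have hω : IsPrimitiveRoot (ζ ^ 5 ^ t) 5 := hζ.pow (by positivity) (pow_succ 5 t)
  obtain ⟨N₁, hN₁⟩ := exists_nat_map_ne_zero (sub_ne_zero.2 (hω.ne_one (by norm_num)))
  obtain ⟨p, hp, hNp, ψ, hψ₁, hψ₂⟩ := exists_prime_not_pow hω y₁ y₂ h₁ h₂ (N + N₁)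
  have := Fact.mk hp
  refine ⟨p, hp, by omega, ?_, ψ, hψ₁, hψ₂⟩
  have : Fact (Nat.Prime 5) := ⟨by norm_num⟩
  have ho : orderOf (ψ ζ) = 5 ^ (t + 1) := by
    refine orderOf_eq_prime_pow (fun h => ?_) ?_
    · refine hN₁ p hp (by omega) ψ ?_
      rw [map_sub, map_pow, h, map_one, sub_self]
    · rw [← map_pow, hζ.pow_eq_one, map_one]
  rw [← ho]
  refine ZMod.orderOf_dvd_card_sub_one fun h => ?_
  have h2 := congrArg ψ hζ.pow_eq_one
  rw [map_pow, h, map_one, zero_pow (by positivity)] at h2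
  exact zero_ne_one h2

theorem ratCast_pow_ne_one {L : Type} [Field L] [NumberField L] {p : ℕ} [Fact p.Prime]
    (ψ : 𝓞 L →+* ZMod p) {m e : ℕ} (hp1 : p - 1 = 5 ^ (m + 1) * e) {b : ℚ} (hb : b.den < p)
    {y : 𝓞 L} (hy : ∀ w, w ^ 5 ≠ ψ y) {n : ℕ}
    (h : (b.den : 𝓞 L) * y ^ 5 ^ m = (n : 𝓞 L) ^ 5 ^ (m + 1) * (b.num : 𝓞 L)) :
    ((b.num : ZMod p) / (b.den : ZMod p)) ^ (2 * e) ≠ 1 := by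
  refine pow_ne_one_of_root (n := (n : ZMod p)) hp1 ?_ hy ?_
  · rw [Ne, ZMod.natCast_eq_zero_iff]
    exact fun hd => absurd (Nat.le_of_dvd b.den_pos hd) (by omega)
  · have := congrArg ψ h
    rwa [map_mul, map_mul, map_pow, map_pow, map_natCast, map_natCast, map_intCast] at this

theorem intCast_pow_ne_one {L : Type} [Field L] [NumberField L] {p : ℕ} [Fact p.Prime]
    (ψ : 𝓞 L →+* ZMod p) {m e : ℕ} (hp1 : p - 1 = 5 ^ (m + 1) * e) {q : ℤ}
    {y : 𝓞 L} (hy : ∀ w, w ^ 5 ≠ ψ y) {n : ℕ}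
    (h : (((q : ℚ).den : ℕ) : 𝓞 L) * y ^ 5 ^ m = (n : 𝓞 L) ^ 5 ^ (m + 1) * ((q : ℚ).num : 𝓞 L)) :
    (q : ZMod p) ^ e ≠ 1 := by
  have hp : p.Prime := Fact.out
  intro hqe
  refine ratCast_pow_ne_one ψ hp1 (b := (q : ℚ)) ?_ hy h ?_
  · rw [Rat.den_intCast]
    exact hp.one_lt
  · rw [Rat.den_intCast, Rat.num_intCast, Nat.cast_one, div_one, mul_comm, pow_mul, hqe, one_pow]

variable {q : ℤ} {r : ℚ} {K : IntermediateField ℚ ℂ} [FiniteDimensional ℚ K]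

theorem false_of_reduction_of_ne (hq : 2 ≤ q) (hr0 : r ≠ 0) (hr1 : |r| ≠ 1)
    (H : ∀ (L : IntermediateField ℚ ℂ) [NumberField L], K ≤ L → ∃ N : ℕ, ∀ p : ℕ, p.Prime → N < p →
      ∀ _ : 𝓞 L →+* ZMod p, ((qFib q p : ℤ) : ZMod p) = r.num * (r.den : ZMod p)⁻¹) : False := by
  obtain ⟨J₁, hJ₁⟩ := exists_integer_root K (abs_pos.2 hr0) hr1
  obtain ⟨J₂, hJ₂⟩ := exists_integer_root K (b := (q : ℚ))
    (by exact_mod_cast (by omega : 0 < q)) (by exact_mod_cast (by omega : q ≠ 1))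
  obtain ⟨M, hMfd, ζ, l, hζ, hζM, hlM, hl, hM⟩ := exists_kummer_field (J₁ + J₂)
  obtain ⟨m₁, hm₁, n₁, -, y₁, hy₁, e₁⟩ := hJ₁ M hM
  obtain ⟨m₂, hm₂, n₂, -, y₂, hy₂, e₂⟩ := hJ₂ M hM
  have hNF := numberField_of_finiteDimensional (K ⊔ M)
  have hML : M ≤ K ⊔ M := le_sup_right
  obtain ⟨ζ', hζ'⟩ := exists_integersToComplex_eq (hML hζM) (hζ.isIntegral (by positivity))
  obtain ⟨l', hl'⟩ := exists_integersToComplex_eq (hML hlM)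
    (IsIntegral.of_pow (by positivity) (isIntegral_of_sq_eq_add_one hl))
  have hζp : IsPrimitiveRoot ζ' (5 ^ (J₁ + J₂ + 1)) :=
    IsPrimitiveRoot.of_map_of_injective (by rwa [hζ']) (integersToComplex_injective (K ⊔ M))
  have hlg : (l' ^ 5 ^ (J₁ + J₂ + 1)) ^ 2 = l' ^ 5 ^ (J₁ + J₂ + 1) + 1 := by
    apply integersToComplex_injective (K ⊔ M)
    rw [map_add, map_pow, map_pow, map_one, hl', hl]
  obtain ⟨N, hN⟩ := H (K ⊔ M) le_sup_left
  obtain ⟨p, hp, hNp, ⟨c, hc⟩, ψ, hψ₁, hψ₂⟩ := exists_prime_cyclotomic hζp hy₁ hy₂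
    (N + |r|.den + q.natAbs)
  have := Fact.mk hp
  have hr := hN p hp (by omega) ψ
  have hq0 : (q : ZMod p) ≠ 0 := by
    rw [Ne, ZMod.intCast_zmod_eq_zero_iff_dvd]
    intro h
    exact absurd (Int.le_of_dvd (by omega) h) (by omega)
  have hp1 : p - 1 = 5 ^ (m₁ + 1) * (5 ^ (J₁ + J₂ - m₁) * c) := by
    rw [hc, ← mul_assoc, ← pow_add]
    congr 2
    omega
  have hp2 : p - 1 = 5 ^ (m₂ + 1) * (5 ^ (J₁ + J₂ - m₂) * c) := by
    rw [hc, ← mul_assoc, ← pow_add]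
    congr 2
    omega
  have hqe := intCast_pow_ne_one ψ hp2 hψ₂ e₂
  obtain ⟨s, I, hs, -, hsI⟩ := exists_qFib_eq_pow hq0 (five_dvd_orderOf hq0 hp2 hqe)
  refine ratCast_pow_ne_one ψ hp1 (by omega) hψ₁ e₁ ?_
  have hl0 : ψ l' ≠ 0 := by
    intro h
    have := congrArg ψ hlg
    rw [map_add, map_pow, map_pow, map_one, h, zero_pow (by positivity)] at this
    simp at this
  have hγ : (ψ l' ^ 5 ^ (J₁ + J₂ + 1)) ^ 2 = ψ l' ^ 5 ^ (J₁ + J₂ + 1) + 1 := by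
    rw [← map_pow, ← map_pow, hlg, map_add, map_one]
  have hs1 : s ^ (2 * c) = 1 := by
    refine pow_eq_one_of_golden hγ hs ?_
    rw [← pow_mul, mul_left_comm, ← hc, mul_comm, pow_mul, ZMod.pow_card_sub_one_eq_one hl0, one_pow]
  have hr2 : ((r.num : ZMod p) / (r.den : ZMod p)) ^ (2 * c) = 1 := by
    rw [div_eq_mul_inv, ← hr, hsI, ← pow_mul, mul_comm, pow_mul, hs1, one_pow]
  have hr3 : (((|r|).num : ZMod p) / ((|r|).den : ZMod p)) ^ (2 * c) = 1 := by
    rcases abs_choice r with h | h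
    · rw [h, hr2]
    · rw [h, Rat.num_neg_eq_neg_num, Rat.den_neg_eq_den, Int.cast_neg, neg_div,
        (even_two_mul c).neg_pow, hr2]
  rw [show 2 * (5 ^ (J₁ + J₂ - m₁) * c) = 2 * c * 5 ^ (J₁ + J₂ - m₁) by ring, pow_mul, hr3, one_pow]

theorem false_of_reduction_of_eq (hq : 2 ≤ q) (hr1 : r = 0 ∨ |r| = 1)
    (H : ∀ (L : IntermediateField ℚ ℂ) [NumberField L], K ≤ L → ∃ N : ℕ, ∀ p : ℕ, p.Prime → N < p →
      ∀ _ : 𝓞 L →+* ZMod p, ((qFib q p : ℤ) : ZMod p) = r.num * (r.den : ZMod p)⁻¹) : False := by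
  obtain ⟨J, hJ⟩ := exists_integer_root K (b := (q : ℚ))
    (by exact_mod_cast (by omega : 0 < q)) (by exact_mod_cast (by omega : q ≠ 1))
  obtain ⟨F, hFfd, ζ, g, hζ, hζF, hgF, hg, hg5, hF⟩ :=
    exists_cyclotomic_field (Module.finrank ℚ K + J)
  obtain ⟨j, hj, y, hy, hyg, hy5⟩ := exists_pow_eq_of_sup K F hgF hg5
  obtain ⟨m, hm, n, -, y₂, hy₂, e₂⟩ := hJ F hF
  have hjK : j < Module.finrank ℚ K := (Nat.lt_pow_self (by norm_num)).trans_le hj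
  have hNF := numberField_of_finiteDimensional (K ⊔ F)
  have hFL : F ≤ K ⊔ F := le_sup_right
  obtain ⟨ζ', hζ'⟩ := exists_integersToComplex_eq (hFL hζF) (hζ.isIntegral (by positivity))
  have hζp : IsPrimitiveRoot ζ' (5 ^ (Module.finrank ℚ K + J + 1)) :=
    IsPrimitiveRoot.of_map_of_injective (by rwa [hζ']) (integersToComplex_injective (K ⊔ F))
  obtain ⟨y₁, hy₁⟩ := exists_integersToComplex_eq hy (IsIntegral.of_pow (n := 5 ^ j) (by positivity)
    (by rw [hyg]; exact isIntegral_of_sq_eq_add_one hg))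
  have hy₁5 : ∀ z : ↥(K ⊔ F), z ^ 5 ≠ y₁ := fun z hz =>
    hy5 z z.2 ((congrArg Subtype.val hz).trans hy₁)
  have hyg' : (y₁ ^ 5 ^ j) ^ 2 = y₁ ^ 5 ^ j + 1 := by
    apply integersToComplex_injective (K ⊔ F)
    rw [map_add, map_pow, map_pow, map_one, hy₁, hyg, hg]
  obtain ⟨N, hN⟩ := H (K ⊔ F) le_sup_left
  obtain ⟨p, hp, hNp, ⟨c, hc⟩, ψ, hψ₁, hψ₂⟩ := exists_prime_cyclotomic hζp hy₁5 hy₂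
    (N + q.natAbs)
  have := Fact.mk hp
  have hr := hN p hp (by omega) ψ
  have hq0 : (q : ZMod p) ≠ 0 := by
    rw [Ne, ZMod.intCast_zmod_eq_zero_iff_dvd]
    intro h
    exact absurd (Int.le_of_dvd (by omega) h) (by omega)
  obtain ⟨i, hi⟩ := Nat.exists_eq_add_of_le (show j + 1 + m ≤ Module.finrank ℚ K + J + 1 by omega)
  have hp0 : p - 1 = 5 ^ (j + 1 + m) * (5 ^ i * c) := by
    rw [hc, hi, pow_add _ _ i, mul_assoc]
  have hp1 : p - 1 = 5 * (5 ^ j * (5 ^ m * (5 ^ i * c))) := by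
    rw [hp0]
    ring
  have hp2 : p - 1 = 5 ^ (m + 1) * (5 ^ j * (5 ^ i * c)) := by
    rw [hp0]
    ring
  have hqe := intCast_pow_ne_one ψ hp2 hψ₂ e₂
  obtain ⟨s, I, hs, hI, hsI⟩ := exists_qFib_eq_pow hq0 (five_dvd_orderOf hq0 hp2 hqe)
  have hy0 : ψ y₁ ≠ 0 := fun h => hψ₁ 0 (by rw [h]; norm_num)
  have hs0 : s ≠ 0 := by
    rintro rfl
    norm_num at hs
  have hsI2 : s ^ (2 * I) = 1 := by
    rw [mul_comm, pow_mul, ← hsI, hr]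
    rcases hr1 with rfl | h
    · exact absurd (hsI.symm.trans hr) (by simpa using pow_ne_zero I hs0)
    · rcases eq_or_eq_neg_of_abs_eq h with rfl | rfl <;> norm_num
  obtain ⟨b, hb⟩ := dvd_pow_mul_of_not_dvd (hp0 ▸ Dvd.intro _ hI)
    (not_dvd_of_pow_ne_one hp2 hI hqe)
  have hγ : (ψ y₁ ^ 5 ^ j) ^ 2 = ψ y₁ ^ 5 ^ j + 1 := by
    rw [← map_pow, ← map_pow, hyg', map_add, map_one]
  have hy2 := pow_eq_one_of_golden hs hγ (e := 5 ^ m * (5 ^ i * c))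
    (by rw [hb, ← mul_assoc, pow_mul, hsI2, one_pow])
  obtain ⟨w, hw⟩ := exists_pow_five_eq hp1 hy0 (by rwa [mul_left_comm, pow_mul])
  exact hψ₁ w hw

end Assembly

/-- For `q ≥ 2`, the element `(F_p(q) mod p)_p` of the poor man's adèle ring is not
represented by the reduction of any C-finite rational sequence: it is A-transcendental. -/
theorem qFib_A_transcendental (q : ℤ) (hq : 2 ≤ q) :
    ¬ ∃ (k : ℕ) (_ : 1 ≤ k) (c : Fin k → ℚ) (u : ℕ → ℚ) (N : ℕ),
      (∀ n : ℕ, u (n + k) = ∑ i : Fin k, c i * u (n + k - 1 - (i : ℕ))) ∧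
      (∀ p : ℕ, p.Prime → N ≤ p →
        Nat.Coprime (u p).den p ∧
        ((u p).num : ZMod p) * ((u p).den : ZMod p)⁻¹ = ((qFib q p : ℤ) : ZMod p)) := by
  rintro ⟨k, -, c, u, N, hrec, hN⟩
  obtain ⟨r, χ, hr⟩ := exists_rat_of_recurrence hrec
  obtain ⟨K, hK, hχ⟩ := exists_splitting_field χ
  have H : ∀ (L : IntermediateField ℚ ℂ) [NumberField L], K ≤ L → ∃ N : ℕ, ∀ p : ℕ, p.Prime →
      N < p → ∀ _ : NumberField.RingOfIntegers L →+* ZMod p,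
        ((qFib q p : ℤ) : ZMod p) = r.num * (r.den : ZMod p)⁻¹ := by
    intro L _ hKL
    obtain ⟨N', hN'⟩ := hr L (hχ L hKL _)
    refine ⟨N + N', fun p hp hNp ψ => ?_⟩
    obtain ⟨h₁, h₂⟩ := hN p hp (by omega)
    rw [← h₂, hN' p hp (by omega) ψ h₁]
  by_cases h : r = 0 ∨ |r| = 1
  · exact false_of_reduction_of_eq hq h H
  · push Not at h
    exact false_of_reduction_of_ne hq h.1 h.2 H
end

section
/- Let t : {primes} → ℤ be a function and suppose there exists an injective sequence of integers a : ℕ → ℤ such that for every n the set of primes p with t_p ≡ a_n (mod p) is infinite. Then there do not exist an integer k ≥ 1, rational constants c_1, …, c_k, a C-finite sequence u : ℕ → ℚ satisfying u_{n+k} = c_1·u_{n+k-1} + ⋯ + c_k·u_n for all n ≥ 0, and a bound N, such that for every prime p ≥ N the denominator of u_p is coprime to p and t_p ≡ u_p (mod p). (That is, an element of the poor man's adèle ring in which infinitely many distinct integers each occur infinitely often is A-transcendental.) -/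
open Polynomial Filter

namespace Valuation

variable {K Γ : Type*} [Field K] [LinearOrderedCommGroupWithZero Γ] (v : Valuation K Γ)

theorem map_intCast_le_one (n : ℤ) : v n ≤ 1 :=
  (v.mem_integer_iff _).1 (intCast_mem v.integer n)

theorem map_le_one_of_isIntegral_int {x : K} (hx : IsIntegral ℤ x) : v x ≤ 1 :=
  (Valuation.integer.integers v).mem_of_integral (hx.tower_top (A := v.integer))

variable {v} {p : ℕ}

theorem map_intCast_lt_one_of_dvd (hv : v (p : K) < 1) {n : ℤ} (hn : (p : ℤ) ∣ n) :
    v (n : K) < 1 := by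
  obtain ⟨m, rfl⟩ := hn
  push_cast
  rw [map_mul]
  exact mul_lt_one_of_lt_of_le hv (v.map_intCast_le_one m)

theorem map_intCast_eq_one_of_not_dvd (hp : p.Prime) (hv : v (p : K) < 1) {n : ℤ}
    (hn : ¬ (p : ℤ) ∣ n) : v (n : K) = 1 := by
  refine (v.map_intCast_le_one n).antisymm (not_lt.1 fun h => ?_)
  obtain ⟨a, b, hab⟩ := ((Nat.prime_iff_prime_int.1 hp).coprime_iff_not_dvd).2 hn
  have h1 : v ((a : K) * p + b * n) < 1 := by
    refine v.map_add_lt ?_ ?_ <;> rw [map_mul]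
    · exact mul_lt_one_of_nonneg_of_lt_one_right (v.map_intCast_le_one a) zero_le hv
    · exact mul_lt_one_of_nonneg_of_lt_one_right (v.map_intCast_le_one b) zero_le h
  rw [show (a : K) * p + b * n = 1 by simpa using congrArg (Int.cast : ℤ → K) hab, map_one] at h1
  exact h1.false

theorem map_aeval_le_one {x : K} (hx : v x ≤ 1) (g : ℤ[X]) : v (aeval x g) ≤ 1 := by
  rw [aeval_eq_sum_range]
  refine v.map_sum_le fun i _ => ?_
  rw [zsmul_eq_mul, map_mul, map_pow]
  exact mul_le_one' (v.map_intCast_le_one _) (pow_le_one' hx i)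

/-- Modulo a place above `p`, raising to the `p`-th power maps roots of an integral polynomial
to roots. -/
theorem map_aeval_pow_prime_lt_one (hp : p.Prime) (hv : v (p : K) < 1) {x : K} (hx : v x ≤ 1)
    {g : ℤ[X]} (hg : aeval x g = 0) : v (aeval (x ^ p) g) < 1 := by
  have := Fact.mk hp
  have hdvd : C (p : ℤ) ∣ expand ℤ p g - g ^ p := by
    rw [C_dvd_iff_dvd_coeff]
    intro i
    have h : (expand ℤ p g - g ^ p).map (Int.castRingHom (ZMod p)) = 0 := by
      rw [Polynomial.map_sub, map_expand, ZMod.expand_card, Polynomial.map_pow, sub_self]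
    have hi := congrArg (coeff · i) h
    rwa [coeff_map, coeff_zero, eq_intCast, ZMod.intCast_zmod_eq_zero_iff_dvd] at hi
  obtain ⟨h, hh⟩ := hdvd
  have key : aeval (x ^ p) g = p * aeval x h := by
    have := congrArg (aeval x) hh
    simpa [hg, hp.ne_zero, expand_aeval] using this
  rw [key, map_mul]
  exact mul_lt_one_of_lt_of_le hv (map_aeval_le_one hx h)

end Valuation

theorem ValuationSubring.exists_valuation_natCast_lt_one (K : Type*) [Field K] [CharZero K]
    {p : ℕ} (hp : p.Prime) : ∃ V : ValuationSubring K, V.valuation (p : K) < 1 := by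
  let A : Subring K := (Int.castRingHom K).range
  have hI : Ideal.span {(p : A)} ≠ ⊤ := by
    rw [Ne, Ideal.span_singleton_eq_top]
    intro h
    obtain ⟨⟨_, n, rfl⟩, hn⟩ := isUnit_iff_exists_inv.1 h
    have h1 : ((p * n : ℤ) : K) = 1 := by simpa using congrArg Subtype.val hn
    have h2 : (p : ℤ) * n = 1 := by exact_mod_cast h1
    exact (Nat.prime_iff_prime_int.1 hp).not_isUnit (IsUnit.of_mul_eq_one _ h2)
  obtain ⟨V, -, hV⟩ := Ideal.image_subset_nonunits_valuationSubring _ hI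
  exact ⟨V, V.mem_nonunits_iff.1 (hV ⟨(p : A), Ideal.mem_span_singleton_self _, by simp⟩)⟩

theorem Algebra.IsAlgebraic.int_of_rat (K : Type*) [Field K] [Algebra ℚ K]
    [Algebra.IsAlgebraic ℚ K] : Algebra.IsAlgebraic ℤ K :=
  (IsFractionRing.comap_isAlgebraic_iff (K := ℚ)).2 inferInstance

section Places

variable {K : Type*} [Field K] [Algebra.IsAlgebraic ℤ K]
  {V : ℕ → ValuationSubring K} (hV : ∀ p : ℕ, p.Prime → (V p).valuation (p : K) < 1)

include hV

omit [Algebra.IsAlgebraic ℤ K] in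
theorem eventually_valuation_intCast_eq_one {d : ℤ} (hd : d ≠ 0) :
    ∀ᶠ p in atTop, p.Prime → (V p).valuation (d : K) = 1 := by
  filter_upwards [eventually_gt_atTop d.natAbs] with p hpd hp
  refine Valuation.map_intCast_eq_one_of_not_dvd hp (hV p hp) fun h => ?_
  exact hpd.not_ge (Nat.le_of_dvd (Int.natAbs_pos.2 hd) (Int.natCast_dvd.1 h))

theorem eventually_valuation_le_one (x : K) :
    ∀ᶠ p in atTop, p.Prime → (V p).valuation x ≤ 1 := by
  obtain ⟨d, hd, hint⟩ :=
    (Algebra.IsAlgebraic.isAlgebraic (R := ℤ) x).exists_integral_multiple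
  filter_upwards [eventually_valuation_intCast_eq_one hV hd] with p hd hp
  have h := (V p).valuation.map_le_one_of_isIntegral_int hint
  rwa [zsmul_eq_mul, map_mul, hd hp, one_mul] at h

theorem eventually_valuation_eq_one {x : K} (hx : x ≠ 0) :
    ∀ᶠ p in atTop, p.Prime → (V p).valuation x = 1 := by
  filter_upwards [eventually_valuation_le_one hV x, eventually_valuation_le_one hV x⁻¹]
    with p h h' hp
  refine (h hp).antisymm ?_
  have := h' hp
  rwa [map_inv₀, inv_le_one₀ (zero_lt_iff.2 ((Valuation.ne_zero_iff _).2 hx))] at this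

/-- The `p`-th power of a fixed algebraic number is congruent to one of finitely many algebraic
numbers modulo places above `p`. -/
theorem exists_finite_pow_prime_sub_valuation_lt_one [CharZero K] [IsAlgClosed K] (x : K) :
    ∃ S : Set K, S.Finite ∧
      ∀ᶠ p in atTop, p.Prime → ∃ y ∈ S, (V p).valuation (x ^ p - y) < 1 := by
  obtain ⟨g, hg0, hg⟩ := Algebra.IsAlgebraic.isAlgebraic (R := ℤ) x
  refine ⟨{y | y ∈ (g.map (algebraMap ℤ K)).roots}, Multiset.finite_toSet _, ?_⟩
  filter_upwards [eventually_valuation_intCast_eq_one hV (leadingCoeff_ne_zero.2 hg0),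
    eventually_valuation_le_one hV x] with p hlead hx hp
  by_contra! hfar
  refine (Valuation.map_aeval_pow_prime_lt_one hp (hV p hp) (hx hp) hg).not_ge ?_
  rw [aeval_def, ← eval_map, (IsAlgClosed.splits _).eval_eq_prod_roots,
    leadingCoeff_map_of_injective (algebraMap ℤ K).injective_int, map_mul, map_multiset_prod,
    eq_intCast, hlead hp, one_mul, Multiset.map_map]
  refine Multiset.one_le_prod fun a ha => ?_
  obtain ⟨y, hy, rfl⟩ := Multiset.mem_map.1 ha
  exact hfar y hy

variable {M : Type*} [AddCommGroup M] [Module K M] (A : Module.End K M) (φ : M →ₗ[K] K)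

theorem eventually_valuation_pow_apply_sub_lt_one {x : K} {w : M}
    (hw : w ∈ A.maxGenEigenspace x) :
    ∀ᶠ p in atTop, p.Prime → (V p).valuation (φ ((A ^ p) w) - x ^ p * φ w) < 1 := by
  obtain ⟨m, hm⟩ := (A.mem_maxGenEigenspace x w).1 hw
  set B := A - x • (1 : Module.End K M) with hB
  have hbound : ∀ᶠ p in atTop, ∀ j ∈ Finset.range m,
      p.Prime → (V p).valuation (φ ((B ^ j) w)) ≤ 1 :=
    (eventually_all_finset _).2 fun j _ => eventually_valuation_le_one hV _
  filter_upwards [hbound, eventually_valuation_le_one hV x, eventually_ge_atTop m]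
    with p hb hx hmp hp
  have hcomm : Commute B (x • (1 : Module.End K M)) := (Commute.one_right B).smul_right x
  have hexp : φ ((A ^ p) w) = ∑ j ∈ Finset.range (p + 1),
      (p.choose j : K) * x ^ (p - j) * φ ((B ^ j) w) := by
    rw [show A = B + x • (1 : Module.End K M) by simp [hB], hcomm.add_pow, LinearMap.sum_apply,
      map_sum]
    refine Finset.sum_congr rfl fun j _ => ?_
    rw [← nsmul_eq_mul', _root_.smul_pow, one_pow, mul_smul_comm, mul_one, LinearMap.smul_apply,
      LinearMap.smul_apply, map_nsmul, map_smul, nsmul_eq_mul, smul_eq_mul, mul_assoc]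
  rw [hexp, Finset.sum_range_succ']
  simp only [Nat.choose_zero_right, Nat.cast_one, one_mul, Nat.sub_zero, pow_zero,
    Module.End.one_apply, add_sub_cancel_right]
  refine Valuation.map_sum_lt _ one_ne_zero fun j hj => ?_
  rcases lt_or_ge (j + 1) m with hjm | hjm
  · rw [map_mul, map_mul, map_pow]
    have hc : (V p).valuation ((p.choose (j + 1) : ℕ) : K) < 1 := by
      have hd : (p : ℤ) ∣ (p.choose (j + 1) : ℤ) :=
        Int.natCast_dvd_natCast.2 (hp.dvd_choose_self j.succ_ne_zero (hjm.trans_le hmp))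
      exact_mod_cast Valuation.map_intCast_lt_one_of_dvd (hV p hp) hd
    exact mul_lt_one_of_lt_of_le (mul_lt_one_of_lt_of_le hc (pow_le_one' (hx hp) _))
      (hb _ (Finset.mem_range.2 hjm) hp)
  · have h0 : (B ^ (j + 1)) w = 0 := by
      rw [← Nat.sub_add_cancel hjm, pow_add, Module.End.mul_apply, hm, map_zero]
    simp [h0]

/-- A linear recurrence sequence over an algebraic closure of `ℚ` takes, at primes `p` and
modulo places above `p`, only finitely many values. -/
theorem exists_finite_pow_apply_sub_valuation_lt_one [CharZero K] [IsAlgClosed K] [FiniteDimensional K M]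
    (w : M) :
    ∃ T : Set K, T.Finite ∧
      ∀ᶠ p in atTop, p.Prime → ∃ y ∈ T, (V p).valuation (φ ((A ^ p) w) - y) < 1 := by
  have hw : w ∈ ⨆ x, A.maxGenEigenspace x := by simp [A.iSup_maxGenEigenspace_eq_top]
  refine Submodule.iSup_induction (motive := fun w => ∃ T : Set K, T.Finite ∧ ∀ᶠ p in atTop,
    p.Prime → ∃ y ∈ T, (V p).valuation (φ ((A ^ p) w) - y) < 1) _ hw ?_ ?_ ?_
  · intro x w hw
    obtain ⟨S, hS, hSp⟩ := exists_finite_pow_prime_sub_valuation_lt_one hV x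
    refine ⟨(· * φ w) '' S, hS.image _, ?_⟩
    filter_upwards [hSp, eventually_valuation_pow_apply_sub_lt_one hV A φ hw,
      eventually_valuation_le_one hV (φ w)] with p hy hsub hφ hp
    obtain ⟨y, hyS, hy⟩ := hy hp
    refine ⟨_, ⟨y, hyS, rfl⟩, ?_⟩
    beta_reduce
    rw [show φ ((A ^ p) w) - y * φ w = (φ ((A ^ p) w) - x ^ p * φ w) + (x ^ p - y) * φ w by ring]
    refine Valuation.map_add_lt _ (hsub hp) ?_
    rw [map_mul]
    exact mul_lt_one_of_lt_of_le hy (hφ hp)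
  · exact ⟨{0}, Set.finite_singleton 0, by simp⟩
  · rintro w w' ⟨T, hT, hTp⟩ ⟨T', hT', hTp'⟩
    refine ⟨Set.image2 (· + ·) T T', hT.image2 _ hT', ?_⟩
    filter_upwards [hTp, hTp'] with p h h' hp
    obtain ⟨y, hy, hyp⟩ := h hp
    obtain ⟨y', hy', hyp'⟩ := h' hp
    refine ⟨_, ⟨y, hy, y', hy', rfl⟩, ?_⟩
    rw [map_add, map_add, add_sub_add_comm]
    exact Valuation.map_add_lt _ hyp hyp'

end Places

theorem LinearRecurrence.tupleSucc_pow_apply {R : Type*} [CommSemiring R]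
    (E : LinearRecurrence R) {u : ℕ → R} (hu : E.IsSolution u) (n : ℕ) :
    (E.tupleSucc ^ n) (fun i : Fin E.order => u i) = fun i : Fin E.order => u (n + i) := by
  induction n with
  | zero => simp
  | succ n ih =>
    rw [pow_succ', Module.End.mul_apply, ih]
    ext i
    simp only [LinearRecurrence.tupleSucc, LinearMap.coe_mk, AddHom.coe_mk]
    split_ifs with h
    · congr 1
      omega
    · rw [← hu n]
      congr 1
      omega

theorem valuation_ratCast_sub_intCast_lt_one {K Γ : Type*} [Field K] [CharZero K]
    [LinearOrderedCommGroupWithZero Γ] {v : Valuation K Γ} {p : ℕ} (hp : p.Prime)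
    (hv : v (p : K) < 1) {r : ℚ} {n : ℤ} (hcop : r.den.Coprime p)
    (h : (r.num : ZMod p) * (r.den : ZMod p)⁻¹ = n) : v ((r : K) - n) < 1 := by
  have := Fact.mk hp
  have hden : ¬ (p : ℤ) ∣ (r.den : ℤ) := fun hd =>
    (hp.coprime_iff_not_dvd.1 hcop.symm) (Int.natCast_dvd_natCast.1 hd)
  have hden' : (r.den : ZMod p) ≠ 0 := by
    rwa [Ne, ← Int.cast_natCast, ZMod.intCast_zmod_eq_zero_iff_dvd]
  have hdvd : (p : ℤ) ∣ r.num - n * r.den := by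
    rw [← ZMod.intCast_zmod_eq_zero_iff_dvd]
    push_cast
    rw [← h, inv_mul_cancel_right₀ hden', sub_self]
  have hlt := Valuation.map_intCast_lt_one_of_dvd hv hdvd
  have hunit : v (r.den : K) = 1 := by
    exact_mod_cast Valuation.map_intCast_eq_one_of_not_dvd hp hv hden
  have hmul : ((r.num - n * r.den : ℤ) : K) = ((r : K) - n) * r.den := by
    have hr : (r : K) * r.den = r.num := by
      exact_mod_cast congrArg (Rat.cast : ℚ → K) r.mul_den_eq_num
    push_cast
    rw [sub_mul, hr]
  rwa [hmul, map_mul, hunit, mul_one] at hlt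


/-- If infinitely many distinct integers each occur infinitely often (modulo `p`) among the
components `t_p` of an element of the poor man's adèle ring, then this element is not
represented by the reduction of any C-finite rational sequence: it is A-transcendental. -/
theorem A_transcendental_of_infinitely_many_values
    (t : {p : ℕ // p.Prime} → ℤ) (a : ℕ → ℤ) (ha : Function.Injective a)
    (hinf : ∀ n : ℕ, {p : {p : ℕ // p.Prime} | (t p : ZMod p) = ((a n : ℤ) : ZMod p)}.Infinite) :
    ¬ ∃ (k : ℕ) (_ : 1 ≤ k) (c : Fin k → ℚ) (u : ℕ → ℚ) (N : ℕ),
      (∀ n : ℕ, u (n + k) = ∑ i : Fin k, c i * u (n + k - 1 - (i : ℕ))) ∧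
      (∀ p : {p : ℕ // p.Prime}, N ≤ (p : ℕ) →
        Nat.Coprime (u p).den p ∧
        ((u p).num : ZMod p) * ((u p).den : ZMod p)⁻¹ = ((t p : ℤ) : ZMod p)) := by
  rintro ⟨k, hk, c, u, N, hrec, hred⟩
  choose! V hV using
    fun p : ℕ => ValuationSubring.exists_valuation_natCast_lt_one (AlgebraicClosure ℚ) (p := p)
  have := @Algebra.IsAlgebraic.int_of_rat (AlgebraicClosure ℚ) _ (AlgebraicClosure.instAlgebra ℚ)
    (AlgebraicClosure.isAlgebraic ℚ)
  let E : LinearRecurrence (AlgebraicClosure ℚ) := ⟨k, fun i => (c i.rev : AlgebraicClosure ℚ)⟩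
  have hsol : E.IsSolution fun n => (u n : AlgebraicClosure ℚ) := by
    intro n
    change ((u (n + k) : ℚ) : AlgebraicClosure ℚ) =
      ∑ i : Fin k, (c i.rev : AlgebraicClosure ℚ) * (u (n + i) : ℚ)
    rw [hrec n, ← Equiv.sum_comp Fin.revPerm, Rat.cast_sum]
    refine Finset.sum_congr rfl fun i _ => ?_
    rw [Rat.cast_mul, Fin.revPerm_apply, Fin.val_rev,
      show n + k - 1 - (k - (i + 1)) = n + (i : ℕ) by omega]
  obtain ⟨T, hT, hTp⟩ := exists_finite_pow_apply_sub_valuation_lt_one hV E.tupleSucc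
    (LinearMap.proj (⟨0, hk⟩ : Fin E.order)) fun i : Fin E.order => (u i : AlgebraicClosure ℚ)
  refine Set.infinite_of_injective_forall_mem
    (f := fun n => (a n : AlgebraicClosure ℚ)) (Int.cast_injective.comp ha) (fun n => ?_) hT
  by_contra hn
  have hfar : ∀ᶠ p in atTop, ∀ y ∈ T, p.Prime → (V p).valuation (y - a n) = 1 :=
    (eventually_all_finite hT).2 fun y hy =>
      eventually_valuation_eq_one hV (sub_ne_zero.2 fun h => hn (h ▸ hy))
  obtain ⟨N', hN'⟩ := eventually_atTop.1 (hTp.and hfar)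
  obtain ⟨p, hpt, hpN⟩ : ∃ p : {p : ℕ // p.Prime},
      (t p : ZMod p) = ((a n : ℤ) : ZMod p) ∧ max N N' ≤ p := by
    by_contra! h
    exact hinf n (((Set.finite_lt_nat (max N N')).preimage
      Subtype.val_injective.injOn).subset fun p hp => h p hp)
  obtain ⟨hTp, hfar⟩ := hN' p (le_of_max_le_right hpN)
  obtain ⟨y, hy, hyp⟩ := hTp p.2
  obtain ⟨hcop, heq⟩ := hred p (le_of_max_le_left hpN)
  have hua := valuation_ratCast_sub_intCast_lt_one p.2 (hV p p.2) hcop (heq.trans hpt)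
  rw [E.tupleSucc_pow_apply hsol] at hyp
  have h := Valuation.map_sub_lt _ hua hyp
  simp only [LinearMap.proj_apply, add_zero, sub_sub_sub_cancel_left, hfar y hy p.2] at h
  exact h.false
end

section
/- For every odd prime p, the truncation at degree p−1 of the binomial series for √(1+x), evaluated at x = 1, satisfies the congruence 1 + ∑_{k=1}^{p−1} (−1)^{k−1}·C_{k−1}/2^{2k−1} ≡ 2·(2/p) (mod p), where C_j = binom(2j, j) − binom(2j, j+1) is the j-th Catalan number and (2/p) is the Legendre symbol of 2 modulo p. -/
/-- The `j`-th Catalan number `C_j = binom(2j, j) − binom(2j, j+1)`, as a rational number. -/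
def catalanQ (j : ℕ) : ℚ := (Nat.choose (2 * j) j : ℚ) - (Nat.choose (2 * j) (j + 1) : ℚ)

theorem catalanQ_eq_catalan (j : ℕ) : catalanQ j = catalan j := by
  have hj : ((j : ℚ) + 1) ≠ 0 := by positivity
  have h1 : ((j : ℚ) + 1) * catalan j = Nat.choose (2 * j) j := by
    exact_mod_cast succ_mul_catalan_eq_centralBinom j
  have h2 : (Nat.choose (2 * j) (j + 1) : ℚ) * (j + 1) = Nat.choose (2 * j) j * j := by
    have h := Nat.choose_succ_right_eq (2 * j) j
    rw [two_mul, Nat.add_sub_cancel, ← two_mul] at h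
    exact_mod_cast h
  apply mul_left_cancel₀ hj
  rw [catalanQ, h1]
  linear_combination -h2

theorem catalan_succ_mul (j : ℕ) : (j + 2) * catalan (j + 1) = 2 * (2 * j + 1) * catalan j := by
  apply Nat.eq_of_mul_eq_mul_left (Nat.add_one_pos j)
  have h1 := succ_mul_catalan_eq_centralBinom j
  have h2 := succ_mul_catalan_eq_centralBinom (j + 1)
  have h3 := Nat.succ_mul_centralBinom_succ j
  rw [← h1, ← h2] at h3
  linear_combination h3

theorem Nat.cast_choose_succ_mul {R : Type*} [CommRing R] (n k : ℕ) :
    (n.choose (k + 1) : R) * (k + 1) = n.choose k * ((n : R) - k) := by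
  rcases le_or_gt k n with h | h
  · rw [← Nat.cast_sub h]
    exact_mod_cast congrArg (Nat.cast (R := R)) (Nat.choose_succ_right_eq n k)
  · simp [Nat.choose_eq_zero_of_lt h, Nat.choose_eq_zero_of_lt (h.trans (Nat.lt_succ_self k))]

theorem Rat.cast_sum_of_den_ne_zero {ι K : Type*} [Field K] (s : Finset ι) (f : ι → ℚ)
    (hf : ∀ i ∈ s, ((f i).den : K) ≠ 0) :
    ((∑ i ∈ s, f i).den : K) ≠ 0 ∧ ((∑ i ∈ s, f i : ℚ) : K) = ∑ i ∈ s, (f i : K) := by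
  classical
  induction s using Finset.induction_on with
  | empty => simp
  | insert a s ha ih =>
    obtain ⟨h1, h2⟩ := ih fun i hi => hf i (Finset.mem_insert_of_mem hi)
    have h3 := hf a (Finset.mem_insert_self a s)
    rw [Finset.sum_insert ha, Finset.sum_insert ha]
    refine ⟨fun h => ?_, by rw [Rat.cast_add_of_ne_zero h3 h1, h2]⟩
    obtain ⟨c, hc⟩ := Rat.add_den_dvd (f a) (∑ i ∈ s, f i)
    have h4 := congrArg (Nat.cast (R := K)) hc
    push_cast at h4
    rw [h, zero_mul] at h4
    exact mul_ne_zero h3 h1 h4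

theorem Rat.cast_intCast_div_two_pow {K : Type*} [Field K] (h2 : (2 : K) ≠ 0) (a : ℤ) (n : ℕ) :
    (((a : ℚ) / 2 ^ n).den : K) ≠ 0 ∧ (((a : ℚ) / 2 ^ n : ℚ) : K) = a / 2 ^ n := by
  have hn : (((2 ^ n : ℤ)) : K) ≠ 0 := by push_cast; exact pow_ne_zero n h2
  have he : (a : ℚ) / 2 ^ n = Rat.divInt a (2 ^ n) := by
    rw [Rat.divInt_eq_div]; push_cast; rfl
  rw [he]
  refine ⟨fun h => hn ?_, by rw [Rat.cast_divInt_of_ne_zero a hn]; push_cast; rfl⟩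
  obtain ⟨c, hc⟩ := Rat.den_dvd a (2 ^ n)
  rw [hc]
  push_cast
  rw [h, zero_mul]

theorem signed_catalan_div_eq_choose {K : Type*} [Field K] (h2 : (2 : K) ≠ 0) (m k : ℕ)
    (hm : 2 * (m : K) = 1) (hk : ∀ i ≤ k, ((i + 1 : ℕ) : K) ≠ 0) :
    (-1 : K) ^ k * catalan k / 2 ^ (2 * k + 1) = m.choose (k + 1) := by
  induction k with
  | zero =>
    simp only [pow_zero, catalan_zero, Nat.choose_one_right, mul_zero, zero_add, pow_one]
    rw [div_eq_iff h2]
    push_cast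
    linear_combination -hm
  | succ k ih =>
    have ih := ih fun i hi => hk i (hi.trans k.le_succ)
    have h0 := hk (k + 1) le_rfl
    have hc := congrArg (Nat.cast (R := K)) (catalan_succ_mul k)
    have hch := Nat.cast_choose_succ_mul (R := K) m (k + 1)
    push_cast at h0 hc hch
    rw [div_eq_iff (pow_ne_zero _ h2)] at ih ⊢
    apply mul_right_cancel₀ h0
    rw [show 2 * (k + 1) + 1 = (2 * k + 1) + 2 by ring, pow_add, pow_succ]
    linear_combination (-(-1 : K) ^ k) * hc - (2 * (2 * (k : K) + 1)) * ih
      - 4 * 2 ^ (2 * k + 1) * hch - 2 * 2 ^ (2 * k + 1) * (m.choose (k + 1) : K) * hm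

/-- For every odd prime `p`, the truncation at degree `p−1` of the binomial series for
`√(1+x)` evaluated at `x = 1` is congruent to `2·(2/p)` modulo `p`. -/
theorem trunc_sqrt_series_congr (p : ℕ) [Fact p.Prime] (hp : p ≠ 2) :
    ((1 + ∑ k ∈ Finset.Icc 1 (p - 1),
        (-1 : ℚ) ^ (k - 1) * catalanQ (k - 1) / 2 ^ (2 * k - 1) : ℚ) : ZMod p) =
      2 * ((legendreSym p 2 : ℤ) : ZMod p) := by
  have hprime : p.Prime := Fact.out
  have hodd : p % 2 = 1 := hprime.eq_two_or_odd.resolve_left hp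
  have h2 : (2 : ZMod p) ≠ 0 := by
    intro h
    have h' : ((2 : ℕ) : ZMod p) = 0 := by exact_mod_cast h
    rw [ZMod.natCast_eq_zero_iff] at h'
    exact hp ((Nat.prime_dvd_prime_iff_eq hprime Nat.prime_two).1 h')
  have hm : 2 * ((p / 2 + 1 : ℕ) : ZMod p) = 1 := by
    have h : 2 * (p / 2 + 1) = p + 1 := by omega
    simpa using congrArg (Nat.cast (R := ZMod p)) h
  have hterm (k : ℕ) : (-1 : ℚ) ^ (k - 1) * catalanQ (k - 1) / 2 ^ (2 * k - 1) =
      (((-1) ^ (k - 1) * catalan (k - 1) : ℤ) : ℚ) / 2 ^ (2 * k - 1) := by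
    rw [catalanQ_eq_catalan]
    push_cast
    rfl
  simp_rw [hterm]
  obtain ⟨hden, hsum⟩ := Rat.cast_sum_of_den_ne_zero (K := ZMod p) (Finset.Icc 1 (p - 1))
    (fun k => (((-1) ^ (k - 1) * catalan (k - 1) : ℤ) : ℚ) / 2 ^ (2 * k - 1))
    fun k _ => (Rat.cast_intCast_div_two_pow h2 _ _).1
  rw [Rat.cast_add_of_ne_zero (by simp) hden, hsum, Rat.cast_one]
  have hchoose : ∀ k ∈ Finset.Icc 1 (p - 1),
      (((((-1) ^ (k - 1) * catalan (k - 1) : ℤ) : ℚ) / 2 ^ (2 * k - 1) : ℚ) : ZMod p) =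
        (p / 2 + 1).choose k := by
    intro k hk
    obtain ⟨j, rfl⟩ := Nat.exists_eq_add_of_le' (Finset.mem_Icc.1 hk).1
    have hj := (Finset.mem_Icc.1 hk).2
    rw [(Rat.cast_intCast_div_two_pow h2 _ _).2, ← signed_catalan_div_eq_choose h2 _ j hm]
    · push_cast
      rfl
    · intro i hi h
      rw [ZMod.natCast_eq_zero_iff] at h
      have := Nat.le_of_dvd i.succ_pos h
      omega
  have hp3 : 3 ≤ p := by have := hprime.two_le; omega
  have hbinom : 1 + ∑ k ∈ Finset.Icc 1 (p - 1), (p / 2 + 1).choose k = 2 ^ (p / 2 + 1) := by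
    rw [← Nat.sum_range_choose, Finset.sum_subset (s₂ := Finset.range p)
      (Finset.range_subset_range.2 (by omega))
      fun k _ hk => Nat.choose_eq_zero_of_lt (by simpa using hk)]
    rw [Finset.range_eq_Ico, Finset.sum_eq_sum_Ico_succ_bot hprime.pos, Nat.choose_zero_right]
    congr 2
  rw [Finset.sum_congr rfl hchoose, legendreSym.eq_pow]
  have := congrArg (Nat.cast (R := ZMod p)) hbinom
  push_cast at this ⊢
  rw [this, pow_succ, mul_comm]
end
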